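/- arXiv:1306.0281 — 2 statements merged into one kernel-verified Lean document; each statement's English description precedes it below -/
import Mathlib

section
/- Let q ≥ 25 and n, m ≥ 1 be integers, α > 0, ε ∈ (0,1/2), and s ≥ √(ln(2n(1+1/ε))/π)/q. Set m' = m − (16n + 4·ln ln q) and let 𝒟 = D_{ℤⁿ, q(α²+s²)^{1/2}} be the discrete Gaussian distribution on ℤⁿ with parameter q(α²+s²)^{1/2}. Then there is a randomized transformation T mapping m elements of T_qⁿ × T to m' elements of T_qⁿ × T (possibly aborting) such that: for every distinguisher f (an arbitrary, not necessarily efficient, randomized {0,1}-valued function on m'-tuples) whose advantage in distinguishing m' independent samples of A_{q,s',D_α} (with s' drawn from 𝒟) from m' independent uniform samples of T_qⁿ × T is ζ, the composed distinguisher f∘T has advantage at least (ζ − 8ε)/4 in distinguishing m independent samples of A_{q,s,D_α} (with s uniform in {0,…,q−1}ⁿ) from m independent uniform samples of T_qⁿ × T. -/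
open MeasureTheory ProbabilityTheory

noncomputable section

namespace LWEPaper

/-- The torus `𝕋 = ℝ/ℤ`. -/
abbrev 𝕋 : Type := UnitAddCircle

/-- Embedding of `T_q = {0, 1/q, …, (q−1)/q} ⊆ 𝕋` (represented by `ZMod q`) into `𝕋`,
sending `x mod q` to `x/q mod 1`. -/
noncomputable def toT {q : ℕ} [NeZero q] (x : ZMod q) : 𝕋 := ZMod.toAddCircle x

/-- The continuous Gaussian `D_α` on `ℝ`, with density proportional to `exp (−π x² / α²)`
(for `α > 0`; it is the Gaussian measure with mean `0` and variance `α²/(2π)`). -/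
@[reducible] noncomputable def contGauss (α : ℝ) : Measure ℝ :=
  gaussianReal 0 (α ^ 2 / (2 * Real.pi)).toNNReal

/-- The sample space `T_qⁿ × 𝕋` of the LWE problem, with `T_qⁿ` represented by
`(ZMod q)ⁿ`. -/
abbrev Samp (n q : ℕ) : Type := (Fin n → ZMod q) × 𝕋

/-- The uniform (Haar/Lebesgue) probability distribution on `𝕋`. -/
noncomputable def uniT : Measure 𝕋 := volume

/-- The LWE distribution `A_{q,s,φ}` on `T_qⁿ × 𝕋`: choose `a` uniformly in `T_qⁿ`,
`e` from the error distribution `φ`, and output `(a, ⟨a,s⟩ + e mod 1)`. -/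
noncomputable def lweA (n q : ℕ) [NeZero q] (s : Fin n → ZMod q) (φ : Measure ℝ) :
    Measure (Samp n q) :=
  (((PMF.uniformOfFintype (Fin n → ZMod q)).toMeasure).prod φ).map
    fun ae => (ae.1, toT (∑ j, ae.1 j * s j) + ((ae.2 : ℝ) : 𝕋))

/-- `m` i.i.d. samples from `A_{q,s,φ}` (with the same secret `s` in every sample). -/
noncomputable def lweSamples (n m q : ℕ) [NeZero q] (s : Fin n → ZMod q) (φ : Measure ℝ) :
    Measure (Fin m → Samp n q) :=
  Measure.pi fun _ : Fin m => lweA n q s φ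

/-- The uniform distribution on `T_qⁿ × 𝕋`. -/
noncomputable def uniSamp (n q : ℕ) [NeZero q] : Measure (Samp n q) :=
  ((PMF.uniformOfFintype (Fin n → ZMod q)).toMeasure).prod uniT

/-- `m` i.i.d. uniform samples from `T_qⁿ × 𝕋`. -/
noncomputable def uniSamples (n m q : ℕ) [NeZero q] : Measure (Fin m → Samp n q) :=
  Measure.pi fun _ : Fin m => uniSamp n q

/-- The advantage of a (randomized) distinguisher, described by its acceptance-probability
function `f`, in distinguishing the distributions `P₀` and `P₁`. -/
noncomputable def adv {X : Type*} [MeasurableSpace X] (f : X → ℝ) (P₀ P₁ : Measure X) : ℝ :=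
  |(∫ x, f x ∂P₀) - ∫ x, f x ∂P₁|

/-- A distinguisher: a measurable acceptance-probability function with values in `[0,1]`
(this models an arbitrary, possibly randomized and not necessarily efficient,
`{0,1}`-valued algorithm). -/
def IsDistinguisher {X : Type*} [MeasurableSpace X] (f : X → ℝ) : Prop :=
  Measurable f ∧ ∀ x, f x ∈ Set.Icc (0 : ℝ) 1

/-- Applying a randomized transformation (Markov kernel) `κ` independently to each of the
`m` samples. -/
noncomputable def samplewise {S S' : Type*} [MeasurableSpace S] [MeasurableSpace S'] (m : ℕ)
    (κ : Kernel S S') (x : Fin m → S) : Measure (Fin m → S') :=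
  Measure.pi fun i => κ (x i)

/-- Euclidean norm of an integer vector. -/
noncomputable def inorm {n : ℕ} (s : Fin n → ℤ) : ℝ := Real.sqrt (∑ i, ((s i : ℝ)) ^ 2)

/-- Reduction of an integer vector modulo `q`. -/
def modq {n : ℕ} (q : ℕ) (s : Fin n → ℤ) : Fin n → ZMod q := fun i => ((s i : ℤ) : ZMod q)

/-- The statistical distance between two measures: the supremum, over measurable events,
of the discrepancy of the two measures (for probability measures this equals half the
total variation of their difference). -/
noncomputable def statDist {Ω : Type*} [MeasurableSpace Ω] (μ ν : Measure Ω) : ℝ :=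
  ⨆ A : { s : Set Ω // MeasurableSet s }, |(μ A).toReal - (ν A).toReal|

/-- A distribution `𝒟` on `ℤⁿ` is `(R,δ)`-bounded if the probability that a vector drawn
from `𝒟` has euclidean norm greater than `R` is at most `δ`. -/
def IsBounded {n : ℕ} (𝒟 : PMF (Fin n → ℤ)) (R δ : ℝ) : Prop :=
  (𝒟.toMeasure {x | R < inorm x}).toReal ≤ δ

/-- `𝒟` is the discrete Gaussian distribution `D_{ℤⁿ,r}`: a probability distribution on
`ℤⁿ` whose mass function is proportional to `ρ_r(x) = exp(−π‖x‖²/r²)` (expressed by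
cross-proportionality, which determines the distribution uniquely). -/
def IsDiscreteGaussian {n : ℕ} (𝒟 : PMF (Fin n → ℤ)) (r : ℝ) : Prop :=
  ∀ x y : Fin n → ℤ,
    (𝒟 x).toReal * Real.exp (-Real.pi * (inorm y) ^ 2 / r ^ 2)
      = (𝒟 y).toReal * Real.exp (-Real.pi * (inorm x) ^ 2 / r ^ 2)

lemma sum_digits_le {b : ℕ} (hb : 1 < b) {n : ℕ} (hn : n ≠ 0) :
    (b.digits n).sum ≤ (b - 1) * (Nat.log b n + 1) := by
  have h := List.sum_le_card_nsmul (b.digits n) (b - 1)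
    (fun x hx => Nat.le_sub_one_of_lt (Nat.digits_lt_base hb hx))
  rw [Nat.length_digits b n hb hn, smul_eq_mul, mul_comm] at h
  exact h

lemma log_div_sub_one_mul_le {p n : ℕ} (hp : p.Prime) (hn : n ≠ 0) :
    (n : ℝ) * (Real.log p / (p - 1)) ≤
      (n.factorial.factorization p : ℝ) * Real.log p + Nat.log p n * Real.log p + Real.log p := by
  have : Fact p.Prime := ⟨hp⟩
  have h1 := sub_one_mul_padicValNat_factorial (p := p) n
  have h2 := sum_digits_le hp.one_lt hn
  have h3 : n ≤ (p - 1) * (n.factorial.factorization p + Nat.log p n + 1) := by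
    rw [Nat.factorization_def _ hp, add_assoc, mul_add, h1]
    omega
  have h4 : (n : ℝ) ≤ (p - 1) * (n.factorial.factorization p + Nat.log p n + 1) := by
    have : ((p - 1 : ℕ) : ℝ) = p - 1 := by rw [Nat.cast_sub hp.one_le]; simp
    rw [← this]; exact_mod_cast h3
  have hp1 : (0 : ℝ) < p - 1 := by
    have : (1 : ℝ) < p := by exact_mod_cast hp.one_lt
    linarith
  have hl : 0 ≤ Real.log p := Real.log_natCast_nonneg p
  calc (n : ℝ) * (Real.log p / (p - 1)) = n / (p - 1) * Real.log p := by ring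
    _ ≤ (n.factorial.factorization p + Nat.log p n + 1) * Real.log p := by
        gcongr
        rw [div_le_iff₀ hp1]; linarith
    _ = _ := by ring

lemma log_four_lt : Real.log 4 < 1.3864 := by
  have : Real.log 4 = 2 * Real.log 2 := by
    rw [show (4 : ℝ) = 2 ^ 2 by norm_num, Real.log_pow]; norm_num
  rw [this]; linarith [Real.log_two_lt_d9]

lemma sum_primesLE_log_div_sub_one_le {n : ℕ} (hn : n ≠ 0) :
    ∑ p ∈ n.primesLE, Real.log p / (p - 1) ≤ Real.log n + 7 := by
  have hn0 : (0 : ℝ) < n := by positivity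
  have h1 : ∑ p ∈ n.primesLE, (n : ℝ) * (Real.log p / (p - 1)) ≤
      ∑ p ∈ n.primesLE, ((n.factorial.factorization p : ℝ) * Real.log p +
        Nat.log p n * Real.log p + Real.log p) :=
    Finset.sum_le_sum fun p hp =>
      log_div_sub_one_mul_le (Nat.prime_of_mem_primesLE hp) hn
  rw [Finset.sum_add_distrib, Finset.sum_add_distrib, ← Chebyshev.psi_eq_sum_mul_log_prime,
    ← Chebyshev.theta_eq_sum_primesLE_log, ← Finset.mul_sum] at h1
  have h2 : ∑ p ∈ n.primesLE, (n.factorial.factorization p : ℝ) * Real.log p =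
      Real.log (n.factorial : ℝ) := by
    rw [Real.log_nat_eq_sum_factorization, Finsupp.sum]
    refine (Finset.sum_subset ?_ ?_).symm
    · intro p hp
      have hpp := Nat.prime_of_mem_primeFactors hp
      rw [Nat.mem_primesLE]
      exact ⟨(hpp.dvd_factorial).1 (Nat.dvd_of_mem_primeFactors hp), hpp⟩
    · intro p _ hp
      rw [Finsupp.notMem_support_iff.1 hp]; simp
  have h3 : Real.log (n.factorial : ℝ) ≤ n * Real.log n := by
    rw [← Real.log_pow]
    apply Real.log_le_log (by exact_mod_cast n.factorial_pos)
    exact_mod_cast n.factorial_le_pow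
  have h4 := Chebyshev.psi_le_const_mul_self hn0.le
  have h5 := Chebyshev.theta_le_log4_mul_x hn0.le
  have h6 := log_four_lt
  rw [h2] at h1
  have : (n : ℝ) * ∑ p ∈ n.primesLE, Real.log p / (p - 1) ≤ n * (Real.log n + 7) := by
    nlinarith
  exact le_of_mul_le_mul_left this hn0

lemma sum_primeFactors_log_le {q : ℕ} (hq : q ≠ 0) :
    ∑ p ∈ q.primeFactors, Real.log p ≤ Real.log q := by
  rw [← Real.log_prod (fun p hp => by
    have := (Nat.prime_of_mem_primeFactors hp).pos; positivity)]
  apply Real.log_le_log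
  · exact Finset.prod_pos fun p hp => by
      have := (Nat.prime_of_mem_primeFactors hp).pos; positivity
  · rw [← Nat.cast_prod]
    exact_mod_cast Nat.le_of_dvd (Nat.pos_of_ne_zero hq) (Nat.prod_primeFactors_dvd q)

lemma three_lt_log_of_le {q : ℕ} (hq : 25 ≤ q) : 3 < Real.log q := by
  rw [Real.lt_log_iff_exp_lt (by positivity)]
  have h := Real.exp_one_lt_d9
  have h1 : Real.exp 3 = Real.exp 1 ^ 3 := by rw [← Real.exp_nat_mul]; norm_num
  have h2 : (25 : ℝ) ≤ q := by exact_mod_cast hq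
  have : Real.exp 1 ^ 3 < 2.72 ^ 3 := by
    gcongr; linarith
  rw [h1]; norm_num at this; linarith

lemma sum_primeFactors_log_div_sub_one_le {q : ℕ} (hq : 25 ≤ q) :
    ∑ p ∈ q.primeFactors, Real.log p / (p - 1) ≤ Real.log (Real.log q) + 9 := by
  set y := Real.log q with hy
  have hy3 : 3 < y := three_lt_log_of_le hq
  set n := ⌊y⌋₊ with hn
  have hn3 : 3 ≤ n := Nat.le_floor (by exact_mod_cast hy3.le)
  have hn3' : (3 : ℝ) ≤ n := by exact_mod_cast hn3
  have hny : (n : ℝ) ≤ y := Nat.floor_le (by linarith)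
  have hyn : y < n + 1 := Nat.lt_floor_add_one y
  rw [← Finset.sum_filter_add_sum_filter_not q.primeFactors (fun p => p ≤ n)]
  have h1 : ∑ p ∈ q.primeFactors with p ≤ n, Real.log p / (p - 1) ≤
      ∑ p ∈ n.primesLE, Real.log p / (p - 1) := by
    apply Finset.sum_le_sum_of_subset_of_nonneg
    · intro p hp
      rw [Finset.mem_filter] at hp
      exact Nat.mem_primesLE.2 ⟨hp.2, Nat.prime_of_mem_primeFactors hp.1⟩
    · intro p hp _
      have : (1 : ℝ) ≤ p := by exact_mod_cast (Nat.prime_of_mem_primesLE hp).one_le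
      exact div_nonneg (Real.log_natCast_nonneg p) (by linarith)
  have h2 := sum_primesLE_log_div_sub_one_le (n := n) (by omega)
  have h3 : ∑ p ∈ q.primeFactors with ¬ p ≤ n, Real.log p / (p - 1) ≤
      ∑ p ∈ q.primeFactors, Real.log p / n := by
    refine (Finset.sum_le_sum fun p hp => ?_).trans
      (Finset.sum_le_sum_of_subset_of_nonneg (Finset.filter_subset _ _) fun p _ _ =>
        div_nonneg (Real.log_natCast_nonneg p) (by linarith))
    rw [Finset.mem_filter, not_le] at hp
    have : (n : ℝ) + 1 ≤ p := by exact_mod_cast hp.2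
    have := Real.log_natCast_nonneg p
    gcongr
    linarith
  rw [← Finset.sum_div] at h3
  have h4 : (∑ p ∈ q.primeFactors, Real.log p) / n ≤ 4 / 3 := by
    rw [div_le_iff₀ (by linarith)]
    have := sum_primeFactors_log_le (q := q) (by omega)
    linarith
  have h5 : Real.log n ≤ Real.log y := Real.log_le_log (by linarith) hny
  linarith

lemma tsum_one_div_rpow_le {δ : ℝ} (hδ : 0 < δ) :
    ∑' n : ℕ, 1 / ((n : ℝ) + 1) ^ (1 + δ) ≤ 1 + 1 / δ := by
  have h := ZetaAsymptotics.zeta_limit_aux1 (s := 1 + δ) (by linarith)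
  have h1 : 0 ≤ ZetaAsymptotics.termTSum (1 + δ) :=
    tsum_nonneg fun n => ZetaAsymptotics.term_nonneg _ _
  have h2 : 0 ≤ ZetaAsymptotics.termTSum (1 + δ) * (1 + δ) := by positivity
  rw [show 1 + δ - 1 = δ by ring] at h
  linarith

lemma prod_inv_one_sub_rpow_le {δ : ℝ} (hδ : 0 < δ) (s : Finset ℕ) (hs : ∀ p ∈ s, p.Prime) :
    ∏ p ∈ s, (1 - (p : ℝ) ^ (-(1 + δ)))⁻¹ ≤ 1 + 1 / δ := by
  let f : ℕ →* ℝ :=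
    { toFun := fun n => (n : ℝ) ^ (-(1 + δ))
      map_one' := by simp
      map_mul' := fun a b => by
        push_cast; exact Real.mul_rpow (by positivity) (by positivity) }
  have hf : ∀ n, f n = (n : ℝ) ^ (-(1 + δ)) := fun n => rfl
  have hsum : Summable (fun n => f n) := by
    simp only [hf]; exact Real.summable_nat_rpow.2 (by linarith)
  have h := EulerProduct.prod_filter_prime_geometric_eq_tsum_factoredNumbers hsum s
  rw [Finset.filter_true_of_mem hs] at h
  simp only [hf] at h
  rw [h]
  have hsum' : Summable (fun n : ℕ => (n : ℝ) ^ (-(1 + δ))) := hsum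
  calc _ ≤ ∑' n : ℕ, (n : ℝ) ^ (-(1 + δ)) :=
        hsum'.tsum_subtype_le _ _ (fun n => by positivity)
    _ = ∑' n : ℕ, 1 / ((n : ℝ) + 1) ^ (1 + δ) := by
        rw [hsum'.tsum_eq_zero_add]
        rw [Nat.cast_zero, Real.zero_rpow (by linarith), zero_add]
        refine tsum_congr fun n => ?_
        push_cast
        rw [Real.rpow_neg (by positivity), one_div]
    _ ≤ _ := tsum_one_div_rpow_le hδ

lemma inv_one_sub_inv_le {p : ℕ} (hp : p.Prime) {δ : ℝ} (hδ : 0 < δ) :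
    (1 - (p : ℝ)⁻¹)⁻¹ ≤
      (1 - (p : ℝ) ^ (-(1 + δ)))⁻¹ * Real.exp (δ * (Real.log p / (p - 1))) := by
  have hp1 : (1 : ℝ) < p := by exact_mod_cast hp.one_lt
  have hp0 : (0 : ℝ) < p := by linarith
  have h1 : (p : ℝ) ^ (-(1 + δ)) < 1 := Real.rpow_lt_one_of_one_lt_of_neg hp1 (by linarith)
  have h2 : (p : ℝ)⁻¹ < 1 := inv_lt_one_of_one_lt₀ hp1
  rw [inv_mul_eq_div, le_div_iff₀ (by linarith), inv_mul_eq_div, div_le_iff₀ (by linarith)]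
  have h3 : (p : ℝ) ^ (-(1 + δ)) = (p : ℝ)⁻¹ * Real.exp (-(δ * Real.log p)) := by
    rw [neg_add, Real.rpow_add hp0, Real.rpow_neg_one, Real.rpow_def_of_pos hp0]
    congr 2; ring
  have h4 : 1 - δ * Real.log p ≤ Real.exp (-(δ * Real.log p)) := by
    have := Real.add_one_le_exp (-(δ * Real.log p)); linarith
  have h5 := Real.add_one_le_exp (δ * (Real.log p / (p - 1)))
  have h6 : (p : ℝ)⁻¹ * (1 - δ * Real.log p) ≤ (p : ℝ) ^ (-(1 + δ)) := by
    rw [h3]; gcongr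
  have h7 : (1 - (p : ℝ)⁻¹) * (δ * (Real.log p / (p - 1)) + 1) =
      1 - (p : ℝ)⁻¹ * (1 - δ * Real.log p) := by
    have : (p : ℝ) - 1 ≠ 0 := by linarith
    field_simp
    ring
  have h8 : (1 - (p : ℝ)⁻¹) * (δ * (Real.log p / (p - 1)) + 1) ≤
      (1 - (p : ℝ)⁻¹) * Real.exp (δ * (Real.log p / (p - 1))) := by
    apply mul_le_mul_of_nonneg_left h5; linarith
  linarith

/-- An explicit lower bound for Euler's totient function. -/
theorem natCast_le_totient_mul_log_log {q : ℕ} (hq : 25 ≤ q) :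
    (q : ℝ) ≤ q.totient * (32 + 8 * Real.log (Real.log q)) := by
  set L := Real.log (Real.log q) with hL
  have hL1 : 1 < L := by
    rw [hL, Real.lt_log_iff_exp_lt (by linarith [three_lt_log_of_le hq])]
    linarith [three_lt_log_of_le hq, Real.exp_one_lt_d9]
  have hδ : 0 < 1 / (L + 9) := by positivity
  have hprod : ∏ p ∈ q.primeFactors, (1 - (p : ℝ)⁻¹)⁻¹ ≤ (L + 10) * Real.exp 1 := by
    have h1p : ∀ p ∈ q.primeFactors, (0 : ℝ) ≤ (1 - (p : ℝ)⁻¹)⁻¹ := fun p hp => by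
      have : (1 : ℝ) < p := by exact_mod_cast (Nat.prime_of_mem_primeFactors hp).one_lt
      have := inv_lt_one_of_one_lt₀ this
      exact inv_nonneg.2 (by linarith)
    calc _ ≤ ∏ p ∈ q.primeFactors, ((1 - (p : ℝ) ^ (-(1 + 1 / (L + 9))))⁻¹ *
            Real.exp (1 / (L + 9) * (Real.log p / (p - 1)))) :=
          Finset.prod_le_prod h1p fun p hp =>
            inv_one_sub_inv_le (Nat.prime_of_mem_primeFactors hp) hδ
      _ = (∏ p ∈ q.primeFactors, (1 - (p : ℝ) ^ (-(1 + 1 / (L + 9))))⁻¹) *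
            Real.exp (1 / (L + 9) * ∑ p ∈ q.primeFactors, Real.log p / (p - 1)) := by
          rw [Finset.prod_mul_distrib, ← Real.exp_sum, Finset.mul_sum]
      _ ≤ (1 + 1 / (1 / (L + 9))) * Real.exp (1 / (L + 9) * (L + 9)) := by
          gcongr
          · exact prod_inv_one_sub_rpow_le hδ _ fun p hp => Nat.prime_of_mem_primeFactors hp
          · exact sum_primeFactors_log_div_sub_one_le hq
      _ = _ := by
          rw [one_div_one_div, one_div_mul_cancel (by positivity)]; ring
  have htot : (q.totient : ℝ) = q * ∏ p ∈ q.primeFactors, (1 - (p : ℝ)⁻¹) := by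
    have := Nat.totient_eq_mul_prod_factors q
    have h := congrArg (fun x : ℚ => (x : ℝ)) this
    push_cast at h
    exact h
  have hpos : 0 < ∏ p ∈ q.primeFactors, (1 - (p : ℝ)⁻¹) := Finset.prod_pos fun p hp => by
    have : (1 : ℝ) < p := by exact_mod_cast (Nat.prime_of_mem_primeFactors hp).one_lt
    have := inv_lt_one_of_one_lt₀ this
    linarith
  rw [Finset.prod_inv_distrib, inv_le_iff_one_le_mul₀ hpos] at hprod
  have he : (L + 10) * Real.exp 1 ≤ 32 + 8 * L := by nlinarith [Real.exp_one_lt_d9]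
  rw [htot, mul_assoc]
  refine le_mul_of_one_le_right (by positivity) ?_
  calc (1 : ℝ) ≤ _ := hprod
    _ = (∏ p ∈ q.primeFactors, (1 - (p : ℝ)⁻¹)) * ((L + 10) * Real.exp 1) := by ring
    _ ≤ _ := by gcongr

lemma natCard_subtype_comp {G H : Type*} [AddCommGroup G] [AddCommGroup H]
    (φ : G →+ H) (hφ : Function.Surjective φ) (P : H → Prop) :
    Nat.card {g // P (φ g)} = Nat.card {h // P h} * Nat.card φ.ker := by
  rw [← Nat.card_prod]
  have hs : ∀ h, φ (Function.surjInv hφ h) = h := Function.surjInv_eq hφ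
  refine Nat.card_congr
    { toFun := fun g => (⟨φ g, g.2⟩, ⟨g - Function.surjInv hφ (φ g), by
        rw [AddMonoidHom.mem_ker, map_sub, hs, sub_self]⟩)
      invFun := fun x => ⟨Function.surjInv hφ x.1 + x.2, by
        rw [map_add, hs, (AddMonoidHom.mem_ker).1 x.2.2, add_zero]; exact x.1.2⟩
      left_inv := fun g => by simp
      right_inv := fun x => by
        have h2 : φ x.2 = 0 := (AddMonoidHom.mem_ker).1 x.2.2
        ext <;> simp [hs, h2] }

lemma natCard_subtype_comp_mul {G H : Type*} [AddCommGroup G] [AddCommGroup H]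
    (φ : G →+ H) (hφ : Function.Surjective φ) (P : H → Prop) :
    Nat.card {g // P (φ g)} * Nat.card H = Nat.card {h // P h} * Nat.card G := by
  have h1 := natCard_subtype_comp φ hφ P
  have h2 := natCard_subtype_comp φ hφ (fun _ => True)
  rw [Nat.card_congr (Equiv.subtypeUnivEquiv fun _ => trivial),
    Nat.card_congr (Equiv.subtypeUnivEquiv fun _ => trivial)] at h2
  rw [h1, h2]; ring

lemma one_sub_sum_le_prod {ι : Type*} (s : Finset ι) (f : ι → ℝ)
    (h0 : ∀ i ∈ s, 0 ≤ f i) (h1 : ∀ i ∈ s, f i ≤ 1) :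
    1 - ∑ i ∈ s, f i ≤ ∏ i ∈ s, (1 - f i) ∧ ∏ i ∈ s, (1 - f i) ≤ 1 := by
  classical
  induction s using Finset.induction_on with
  | empty => simp
  | insert a s ha ih =>
    obtain ⟨i1, i2⟩ := ih (fun i hi => h0 i (Finset.mem_insert_of_mem hi))
      (fun i hi => h1 i (Finset.mem_insert_of_mem hi))
    have a0 := h0 a (Finset.mem_insert_self a s)
    have a1 := h1 a (Finset.mem_insert_self a s)
    have hp : 0 ≤ ∏ i ∈ s, (1 - f i) := Finset.prod_nonneg fun i hi => by
      linarith [h1 i (Finset.mem_insert_of_mem hi)]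
    rw [Finset.sum_insert ha, Finset.prod_insert ha]
    constructor <;> nlinarith

lemma natCard_subtype_not {α : Type*} [Finite α] (P : α → Prop) :
    (Nat.card {a // ¬ P a} : ℝ) = Nat.card α - Nat.card {a // P a} := by
  have : Nat.card α = Nat.card {a // P a} + Nat.card {a // ¬ P a} := by
    classical
    rw [← Nat.card_sum]; exact Nat.card_congr (Equiv.sumCompl P).symm
  rw [this]; push_cast; ring

lemma card_not_linearIndependent_le (p k : ℕ) [Fact p.Prime] :
    (Nat.card {v : Fin k → Fin (k + 1) → ZMod p // ¬ LinearIndependent (ZMod p) v} : ℝ) ≤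
      Nat.card (Fin k → Fin (k + 1) → ZMod p) * (1 / (p * (p - 1))) := by
  have hp : (1 : ℝ) < p := by exact_mod_cast (Fact.out : p.Prime).one_lt
  have hp0 : (0 : ℝ) < p := by linarith
  rw [natCard_subtype_not, card_linearIndependent (by simp)]
  have hcard : (Nat.card (Fin k → Fin (k + 1) → ZMod p) : ℝ) =
      ∏ i : Fin k, (p : ℝ) ^ (k + 1) := by
    simp
  have hprod : ((∏ i : Fin k, (Fintype.card (ZMod p) ^
        Module.finrank (ZMod p) (Fin (k + 1) → ZMod p) - Fintype.card (ZMod p) ^ i.val) : ℕ) : ℝ) =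
      Nat.card (Fin k → Fin (k + 1) → ZMod p) *
        ∏ i : Fin k, (1 - 1 / (p : ℝ) ^ (k + 1 - i.val)) := by
    rw [hcard, ← Finset.prod_mul_distrib, Nat.cast_prod]
    refine Finset.prod_congr rfl fun i _ => ?_
    rw [ZMod.card, Module.finrank_fin_fun, Nat.cast_sub
      (Nat.pow_le_pow_right (Fact.out : p.Prime).pos (by omega))]
    push_cast
    rw [mul_sub, mul_one, mul_one_div, eq_comm]
    congr 1
    rw [div_eq_iff (by positivity), ← pow_add]
    congr 1; omega
  rw [hprod]
  have h1 := (one_sub_sum_le_prod Finset.univ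
    (fun i : Fin k => 1 / (p : ℝ) ^ (k + 1 - i.val)) (fun i _ => by positivity)
    (fun i _ => by
      rw [div_le_one (by positivity)]; exact one_le_pow₀ hp.le)).1
  have h2 : ∑ i : Fin k, 1 / (p : ℝ) ^ (k + 1 - i.val) ≤ 1 / (p * (p - 1)) := by
    rw [Fin.sum_univ_eq_sum_range (fun i => 1 / (p : ℝ) ^ (k + 1 - i)) k,
      ← Finset.sum_range_reflect]
    have : ∀ j ∈ Finset.range k, 1 / (p : ℝ) ^ (k + 1 - (k - 1 - j)) =
        (1 / (p : ℝ) ^ 2) * (1 / (p : ℝ)) ^ j := fun j hj => by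
      rw [Finset.mem_range] at hj
      rw [show k + 1 - (k - 1 - j) = 2 + j by omega, pow_add, one_div_pow]
      field_simp
    rw [Finset.sum_congr rfl this, ← Finset.mul_sum]
    have hg : ∑ j ∈ Finset.range k, (1 / (p : ℝ)) ^ j ≤ (1 - 1 / (p : ℝ))⁻¹ := by
      have hlt : 1 / (p : ℝ) < 1 := by rw [div_lt_one hp0]; exact hp
      rw [← tsum_geometric_of_lt_one (by positivity) hlt]
      exact (summable_geometric_of_lt_one (by positivity) hlt).sum_le_tsum _
        (fun _ _ => by positivity)
    calc _ ≤ 1 / (p : ℝ) ^ 2 * (1 - 1 / (p : ℝ))⁻¹ := by gcongr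
      _ = _ := by
        have : (p : ℝ) - 1 ≠ 0 := by linarith
        field_simp
  have h3 : (0 : ℝ) ≤ Nat.card (Fin k → Fin (k + 1) → ZMod p) := by positivity
  have h4 : 1 - ∏ i : Fin k, (1 - 1 / (p : ℝ) ^ (k + 1 - i.val)) ≤ 1 / (p * (p - 1)) := by
    linarith
  calc _ = (Nat.card (Fin k → Fin (k + 1) → ZMod p) : ℝ) *
        (1 - ∏ i : Fin k, (1 - 1 / (p : ℝ) ^ (k + 1 - i.val))) := by ring
    _ ≤ _ := by gcongr

lemma sum_primesBelow_le (k : ℕ) :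
    ∑ p ∈ Nat.primesBelow (2 * k + 5), 1 / ((p : ℝ) * (p - 1)) ≤
      5 / 6 - 1 / (2 * (2 * k + 3)) := by
  induction k with
  | zero =>
    have : Nat.primesBelow (2 * 0 + 5) = {2, 3} := by decide
    rw [this]; norm_num
  | succ k ih =>
    have h6 : ¬ (2 * k + 6).Prime := fun h => by
      have := h.eq_one_or_self_of_dvd 2 ⟨k + 3, by ring⟩
      omega
    have hstep : ∑ p ∈ Nat.primesBelow (2 * (k + 1) + 5), 1 / ((p : ℝ) * (p - 1)) ≤
        ∑ p ∈ Nat.primesBelow (2 * k + 5), 1 / ((p : ℝ) * (p - 1)) +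
          1 / ((2 * k + 5) * (2 * k + 4)) := by
      have hsub : Nat.primesBelow (2 * (k + 1) + 5) ⊆
          insert (2 * k + 5) (Nat.primesBelow (2 * k + 5)) := by
        intro p hp
        rw [Nat.mem_primesBelow] at hp
        rw [Finset.mem_insert, Nat.mem_primesBelow]
        by_contra hcon
        push Not at hcon
        have : p = 2 * k + 6 := by
          by_contra hne
          exact hcon.2 (by omega) hp.2
        exact h6 (this ▸ hp.2)
      refine (Finset.sum_le_sum_of_subset_of_nonneg hsub fun p hp _ => ?_).trans ?_
      · have : (1 : ℝ) ≤ p := by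
          rw [Finset.mem_insert] at hp
          rcases hp with rfl | hp
          · push_cast; linarith [(Nat.cast_nonneg k : (0 : ℝ) ≤ k)]
          · exact_mod_cast (Nat.prime_of_mem_primesBelow hp).one_le
        exact div_nonneg zero_le_one (mul_nonneg (by linarith) (by linarith))
      · rw [Finset.sum_insert (by simp [Nat.mem_primesBelow])]
        push_cast
        rw [add_comm]
        gcongr
        linarith
    have hk : (0 : ℝ) ≤ k := Nat.cast_nonneg k
    have hfin : (1 : ℝ) / ((2 * k + 5) * (2 * k + 4)) ≤
        1 / (2 * (2 * k + 3)) - 1 / (2 * (2 * (k + 1) + 3)) := by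
      have : (1 : ℝ) / (2 * (2 * k + 3)) - 1 / (2 * (2 * (k + 1) + 3)) =
          1 / ((2 * k + 5) * (2 * k + 3)) := by
        field_simp; ring
      rw [this]
      gcongr; norm_num
    push_cast
    linarith

lemma sum_primeFactors_le (q : ℕ) :
    ∑ p ∈ q.primeFactors, 1 / ((p : ℝ) * (p - 1)) ≤ 5 / 6 := by
  refine (Finset.sum_le_sum_of_subset_of_nonneg (t := Nat.primesBelow (2 * q + 5)) ?_ ?_).trans
    ((sum_primesBelow_le q).trans ?_)
  · intro p hp
    exact Nat.mem_primesBelow.2 ⟨by have := Nat.le_of_mem_primeFactors hp; omega,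
      Nat.prime_of_mem_primeFactors hp⟩
  · intro p hp _
    have : (1 : ℝ) ≤ p := by exact_mod_cast (Nat.prime_of_mem_primesBelow hp).one_le
    exact div_nonneg zero_le_one (mul_nonneg (by linarith) (by linarith))
  · have : (0 : ℝ) ≤ 1 / (2 * (2 * q + 3)) := by positivity
    linarith

/-- The vectors `v` over `ZMod q` are linearly independent modulo every prime divisor of `q`. -/
def IndepModPrimes {q k n : ℕ} (v : Fin k → Fin n → ZMod q) : Prop :=
  ∀ p : ℕ, p.Prime → (hp : p ∣ q) →
    LinearIndependent (ZMod p) fun i j => ZMod.castHom hp (ZMod p) (v i j)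

lemma card_not_indepModPrimes_le (q k : ℕ) [NeZero q] :
    (Nat.card {v : Fin k → Fin (k + 1) → ZMod q // ¬ IndepModPrimes v} : ℝ) ≤
      5 / 6 * Nat.card (Fin k → Fin (k + 1) → ZMod q) := by
  let P : q.primeFactors → (Fin k → Fin (k + 1) → ZMod q) → Prop := fun p v =>
    ¬ LinearIndependent (ZMod p) fun i j =>
      ZMod.castHom (Nat.dvd_of_mem_primeFactors p.2) (ZMod p) (v i j)
  have h1 : Nat.card {v : Fin k → Fin (k + 1) → ZMod q // ¬ IndepModPrimes v} ≤
      ∑ p : q.primeFactors, Nat.card {v // P p v} := by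
    have := Set.ncard_iUnion_le_of_fintype fun p : q.primeFactors => {v | P p v}
    refine le_trans ?_ this
    rw [← Nat.card_coe_set_eq]
    refine Nat.card_mono (Set.toFinite _) fun v (hv : ¬ IndepModPrimes v) => ?_
    unfold IndepModPrimes at hv
    push Not at hv
    obtain ⟨p, hp, hpq, hv⟩ := hv
    exact Set.mem_iUnion.2 ⟨⟨p, Nat.mem_primeFactors.2 ⟨hp, hpq, NeZero.ne q⟩⟩, hv⟩
  have h2 : ∀ p : q.primeFactors, (Nat.card {v // P p v} : ℝ) ≤
      Nat.card (Fin k → Fin (k + 1) → ZMod q) * (1 / ((p : ℕ) * ((p : ℕ) - 1))) := by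
    intro p
    have : Fact (p : ℕ).Prime := ⟨Nat.prime_of_mem_primeFactors p.2⟩
    let φ : (Fin k → Fin (k + 1) → ZMod q) →+ (Fin k → Fin (k + 1) → ZMod p) :=
      { toFun := fun v i j => ZMod.castHom (Nat.dvd_of_mem_primeFactors p.2) (ZMod p) (v i j)
        map_zero' := by ext; simp
        map_add' := fun a b => by ext i j; simp only [Pi.add_apply, map_add] }
    have hφ : Function.Surjective φ := fun w => by
      choose v hv using fun i j =>
        ZMod.castHom_surjective (Nat.dvd_of_mem_primeFactors p.2) (w i j)
      exact ⟨v, by ext i j; exact hv i j⟩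
    have h3 := natCard_subtype_comp_mul φ hφ (fun w => ¬ LinearIndependent (ZMod p) w)
    have h4 := card_not_linearIndependent_le p k
    have h5 : (0 : ℝ) < Nat.card (Fin k → Fin (k + 1) → ZMod p) := by
      exact_mod_cast Nat.card_pos
    have h6 : (Nat.card {v // P p v} : ℝ) * Nat.card (Fin k → Fin (k + 1) → ZMod p) =
        Nat.card {w : Fin k → Fin (k + 1) → ZMod p // ¬ LinearIndependent (ZMod p) w} *
          Nat.card (Fin k → Fin (k + 1) → ZMod q) := by exact_mod_cast h3
    refine le_of_mul_le_mul_right ?_ h5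
    rw [h6]
    nlinarith [(Nat.cast_nonneg (Nat.card (Fin k → Fin (k + 1) → ZMod q)) : (0 : ℝ) ≤ _)]
  have h3 := sum_primeFactors_le q
  calc (Nat.card {v : Fin k → Fin (k + 1) → ZMod q // ¬ IndepModPrimes v} : ℝ)
      ≤ ∑ p : q.primeFactors, (Nat.card {v // P p v} : ℝ) := by exact_mod_cast h1
    _ ≤ ∑ p : q.primeFactors, Nat.card (Fin k → Fin (k + 1) → ZMod q) *
          (1 / (((p : ℕ) : ℝ) * ((p : ℕ) - 1))) := Finset.sum_le_sum fun p _ => h2 p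
    _ = Nat.card (Fin k → Fin (k + 1) → ZMod q) *
          ∑ p ∈ q.primeFactors, 1 / ((p : ℝ) * (p - 1)) := by
        rw [← Finset.mul_sum, Finset.sum_coe_sort q.primeFactors
          (fun p => 1 / ((p : ℝ) * (p - 1)))]
    _ ≤ Nat.card (Fin k → Fin (k + 1) → ZMod q) * (5 / 6) := by gcongr
    _ = _ := by ring

/-- The linear form `a ↦ det (a, v₁, …, vₖ)`. -/
def detCons {q k : ℕ} (v : Fin k → Fin (k + 1) → ZMod q) :
    (Fin (k + 1) → ZMod q) →ₗ[ZMod q] ZMod q where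
  toFun a := (Matrix.of (Fin.cons a v : Fin (k + 1) → Fin (k + 1) → ZMod q)).det
  map_add' a b := by
    have := (Matrix.detRowAlternating (R := ZMod q) (n := Fin (k + 1))).map_update_add
      (Fin.cons 0 v) 0 a b
    simp only [Fin.update_cons_zero] at this
    exact this
  map_smul' c a := by
    have := (Matrix.detRowAlternating (R := ZMod q) (n := Fin (k + 1))).map_update_smul
      (Fin.cons 0 v) 0 c a
    simp only [Fin.update_cons_zero] at this
    exact this

lemma exists_det_cons_ne_zero {F : Type*} [Field F] {k : ℕ} {v : Fin k → Fin (k + 1) → F}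
    (hv : LinearIndependent F v) :
    ∃ a, (Matrix.of (Fin.cons a v : Fin (k + 1) → Fin (k + 1) → F)).det ≠ 0 := by
  have hspan : Submodule.span F (Set.range v) ≠ ⊤ := fun h => by
    have h1 := finrank_range_le_card (R := F) (b := v)
    rw [Set.finrank, h, finrank_top, Module.finrank_fin_fun, Fintype.card_fin] at h1
    omega
  obtain ⟨a, ha⟩ : ∃ a, a ∉ Submodule.span F (Set.range v) := by
    by_contra hcon
    push Not at hcon
    exact hspan (Submodule.eq_top_iff'.2 hcon)
  refine ⟨a, ?_⟩
  have hl : LinearIndependent F (Fin.cons a v : Fin (k + 1) → Fin (k + 1) → F) :=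
    linearIndependent_finCons.2 ⟨hv, ha⟩
  have := Matrix.linearIndependent_rows_iff_isUnit.1
    (show LinearIndependent F (Matrix.of (Fin.cons a v : Fin (k + 1) → Fin (k + 1) → F)).row
      from hl)
  exact ((Matrix.isUnit_iff_isUnit_det _).1 this).ne_zero

lemma ideal_eq_top_of_forall_prime {q : ℕ} [NeZero q] (I : Ideal (ZMod q))
    (hI : ∀ p : ℕ, p.Prime → (hp : p ∣ q) → ∃ x ∈ I, ZMod.castHom hp (ZMod p) x ≠ 0) :
    I = ⊤ := by
  obtain ⟨g, hg⟩ := (IsPrincipalIdealRing.principal (I.comap (Int.castRingHom (ZMod q)))).principal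
  rw [← Ideal.span] at hg
  have hq : (q : ℤ) ∈ I.comap (Int.castRingHom (ZMod q)) := by
    rw [Ideal.mem_comap]; simp
  rw [hg, Ideal.mem_span_singleton] at hq
  by_cases h1 : g.natAbs = 1
  · rw [Ideal.eq_top_iff_one]
    have : (1 : ℤ) ∈ I.comap (Int.castRingHom (ZMod q)) := by
      rw [hg, Ideal.mem_span_singleton]
      exact (Int.isUnit_iff_natAbs_eq.2 h1).dvd
    simpa [Ideal.mem_comap] using this
  · obtain ⟨p, hp, hpg⟩ := Nat.exists_prime_and_dvd h1
    have hpg' : (p : ℤ) ∣ g := Int.natCast_dvd.2 hpg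
    have hpq : p ∣ q := by exact_mod_cast hpg'.trans hq
    obtain ⟨x, hx, hx0⟩ := hI p hp hpq
    obtain ⟨y, rfl⟩ := ZMod.intCast_surjective x
    have hy : y ∈ I.comap (Int.castRingHom (ZMod q)) := by
      rw [Ideal.mem_comap]; exact hx
    rw [hg, Ideal.mem_span_singleton] at hy
    exact absurd (by rw [map_intCast]; exact (ZMod.intCast_zmod_eq_zero_iff_dvd _ _).2 (hpg'.trans hy)) hx0

lemma detCons_surjective {q k : ℕ} [NeZero q] {v : Fin k → Fin (k + 1) → ZMod q}
    (hv : IndepModPrimes v) : Function.Surjective (detCons v) := by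
  rw [← LinearMap.range_eq_top]
  refine ideal_eq_top_of_forall_prime _ fun p hp hpq => ?_
  have : Fact p.Prime := ⟨hp⟩
  obtain ⟨b, hb⟩ := exists_det_cons_ne_zero (hv p hp hpq)
  choose a ha using fun j => ZMod.castHom_surjective hpq (b j)
  refine ⟨detCons v a, LinearMap.mem_range_self _ a, ?_⟩
  convert hb using 1
  change ZMod.castHom hpq (ZMod p) (Matrix.det _) = _
  rw [RingHom.map_det]
  congr 1
  ext i j
  refine Fin.cases ?_ (fun i => ?_) i
  · simpa using ha j
  · simp

lemma card_isUnit_detCons {q k : ℕ} [NeZero q] {v : Fin k → Fin (k + 1) → ZMod q}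
    (hv : IndepModPrimes v) :
    Nat.card {a // IsUnit (detCons v a)} * q =
      q.totient * Nat.card (Fin (k + 1) → ZMod q) := by
  have h := natCard_subtype_comp_mul (detCons v).toAddMonoidHom (detCons_surjective hv) IsUnit
  have h1 : Nat.card {x : ZMod q // IsUnit x} = q.totient := by
    rw [← ZMod.card_units_eq_totient, ← Nat.card_eq_fintype_card]
    exact (Nat.card_congr (Equiv.ofBijective (fun u : (ZMod q)ˣ => (⟨u, u.isUnit⟩ : {x : ZMod q // IsUnit x}))
      ⟨fun u v h => Units.ext (congrArg Subtype.val h), fun x => ⟨x.2.unit, rfl⟩⟩)).symm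
  rw [h1, Nat.card_zmod] at h
  exact h

/-- The family `A` of vectors over `ZMod q` has a subfamily forming a basis. -/
def HasUnitMinor {ι : Type*} {n q : ℕ} (A : ι → Fin n → ZMod q) : Prop :=
  ∃ σ : Fin n → ι, Function.Injective σ ∧ IsUnit (Matrix.of fun i => A (σ i)).det

lemma one_sub_pow_le_of_half_le {x : ℝ} {K : ℕ} (hx : x ≤ 1) (hK : 1 / 2 ≤ x * K) :
    (1 - x) ^ K ≤ 0.61 := by
  have h1 : (1 - x) ^ K ≤ Real.exp (-x) ^ K := by
    apply pow_le_pow_left₀ (by linarith)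
    linarith [Real.add_one_le_exp (-x)]
  have h2 : Real.exp (-x) ^ K ≤ Real.exp (-(1 / 2)) := by
    rw [← Real.exp_nat_mul, Real.exp_le_exp]; linarith
  have h3 : Real.exp (-(1 / 2)) ≤ 0.61 := by
    have h5 : Real.exp (-(1 / 2)) ^ 2 = (Real.exp 1)⁻¹ := by
      rw [← Real.exp_nat_mul, ← Real.exp_neg]; norm_num
    have h6 : (Real.exp 1)⁻¹ ≤ 0.61 ^ 2 := by
      rw [inv_le_comm₀ (Real.exp_pos 1) (by norm_num)]
      have := Real.exp_one_gt_d9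
      norm_num; linarith
    rw [← h5] at h6
    exact (pow_le_pow_iff_left₀ (Real.exp_pos _).le (by norm_num) two_ne_zero).1 h6
  linarith

lemma natCard_subtype_forall {ι α : Type*} [Fintype ι] (P : α → Prop) :
    Nat.card {f : ι → α // ∀ i, P (f i)} = Nat.card {a // P a} ^ Fintype.card ι := by
  rw [Nat.card_congr (Equiv.subtypePiEquivPi (p := fun _ : ι => P)), Nat.card_pi]
  simp

lemma natCard_subtype_exists {ι α : Type*} [Fintype ι] [Finite α] (P : α → Prop) :
    (Nat.card {f : ι → α // ∃ i, P (f i)} : ℝ) =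
      (Nat.card α : ℝ) ^ Fintype.card ι -
        (Nat.card α - Nat.card {a // P a} : ℝ) ^ Fintype.card ι := by
  have h := natCard_subtype_not fun f : ι → α => ∀ i, ¬ P (f i)
  simp only [not_forall, not_not] at h
  rw [h, natCard_subtype_forall (fun a => ¬ P a), Nat.cast_pow, natCard_subtype_not,
    Nat.card_fun, Nat.card_eq_fintype_card (α := ι)]
  push_cast; rfl

lemma card_exists_isUnit_detCons_ge {q k K : ℕ} (hq : 25 ≤ q)
    (hK : 16 + 4 * Real.log (Real.log q) ≤ K) {v : Fin k → Fin (k + 1) → ZMod q}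
    (hv : IndepModPrimes v) :
    0.39 * (Nat.card (Fin (k + 1) → ZMod q) : ℝ) ^ K ≤
      Nat.card {c : Fin K → Fin (k + 1) → ZMod q // ∃ i, IsUnit (detCons v (c i))} := by
  have : NeZero q := ⟨by omega⟩
  have hq0 : (0 : ℝ) < q := by positivity
  have h1 := natCast_le_totient_mul_log_log hq
  have h2 : (Nat.card {a // IsUnit (detCons v a)} : ℝ) * q =
      q.totient * Nat.card (Fin (k + 1) → ZMod q) := by exact_mod_cast card_isUnit_detCons hv
  set C : ℝ := (Nat.card (Fin (k + 1) → ZMod q) : ℝ)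
  have h3 : (Nat.card {a // IsUnit (detCons v a)} : ℝ) = C * (q.totient / q) := by
    field_simp; linarith
  have hx1 : (q.totient : ℝ) / q ≤ 1 := by
    rw [div_le_one hq0]; exact_mod_cast q.totient_le
  have hx2 : 1 / 2 ≤ (q.totient : ℝ) / q * K := by
    rw [div_mul_eq_mul_div, le_div_iff₀ hq0]
    nlinarith [(Nat.cast_nonneg q.totient : (0 : ℝ) ≤ _)]
  have h4 := one_sub_pow_le_of_half_le hx1 hx2
  rw [natCard_subtype_exists (fun a => IsUnit (detCons v a)), h3, Fintype.card_fin,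
    show C - C * (q.totient / q) = C * (1 - q.totient / q) by ring, mul_pow]
  have : 0 ≤ C ^ K := by positivity
  nlinarith

lemma hasUnitMinor_of_isUnit_detCons {ι : Type*} {q k : ℕ} {A : ι → Fin (k + 1) → ZMod q}
    {τ : Fin k → ι} {i : ι} (hτ : Function.Injective τ) (hi : ∀ l, τ l ≠ i)
    (h : IsUnit (detCons (fun l => A (τ l)) (A i))) : HasUnitMinor A := by
  refine ⟨Fin.cons i τ, Fin.cons_injective_iff.2 ⟨?_, hτ⟩, ?_⟩
  · rintro ⟨l, hl⟩; exact hi l hl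
  · convert h using 1
    change _ = Matrix.det _
    congr 1
    ext a b
    refine Fin.cases ?_ (fun a => ?_) a <;> simp

/-- Random vectors over `ZMod q` contain a basis with probability at least `1/4`. -/
theorem quarter_mul_card_le_card_hasUnitMinor {n q N : ℕ} (hq : 25 ≤ q) (hn : 1 ≤ n)
    (hN : 16 * (n : ℝ) + 4 * Real.log (Real.log q) ≤ N) :
    1 / 4 * (Nat.card (Fin N → Fin n → ZMod q) : ℝ) ≤
      Nat.card {A : Fin N → Fin n → ZMod q // HasUnitMinor A} := by
  have : NeZero q := ⟨by omega⟩
  obtain ⟨k, rfl⟩ : ∃ k, n = k + 1 := ⟨n - 1, by omega⟩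
  have hL : 0 ≤ Real.log (Real.log q) :=
    Real.log_nonneg (by linarith [three_lt_log_of_le hq])
  have hk0 : (0 : ℝ) ≤ k := by positivity
  push_cast at hN
  have hN8 : 8 * k ≤ N := by
    have : (8 * k : ℝ) ≤ N := by linarith
    exact_mod_cast this
  obtain ⟨K, rfl⟩ := Nat.exists_eq_add_of_le hN8
  push_cast at hN
  have hK : 16 + 4 * Real.log (Real.log q) ≤ K := by linarith
  set V := Fin (k + 1) → ZMod q with hV
  let e : Fin (8 * k + K) ≃ (Fin 8 × Fin k) ⊕ Fin K :=
    finSumFinEquiv.symm.trans (Equiv.sumCongr finProdFinEquiv.symm (Equiv.refl _))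
  let E : (Fin (8 * k + K) → V) ≃ (Fin 8 → Fin k → V) × (Fin K → V) :=
    ((Equiv.arrowCongr e (Equiv.refl V)).trans (Equiv.sumArrowEquivProdArrow _ _ _)).trans
      (Equiv.prodCongr (Equiv.curry _ _ _) (Equiv.refl _))
  let B := {b : Fin 8 → Fin k → V // ∃ j, IndepModPrimes (b j)}
  let J : B → Fin 8 := fun b => b.2.choose
  have hJ : ∀ b : B, IndepModPrimes (b.1 (J b)) := fun b => b.2.choose_spec
  let S := Σ b : B, {c : Fin K → V // ∃ i, IsUnit (detCons (b.1 (J b)) (c i))}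
  let F : S → {A : Fin (8 * k + K) → V // HasUnitMinor A} := fun x =>
    ⟨E.symm (x.1.1, x.2.1), by
      obtain ⟨i, hi⟩ := x.2.2
      refine hasUnitMinor_of_isUnit_detCons (τ := fun l => e.symm (.inl (J x.1, l)))
        (i := e.symm (.inr i)) (fun l l' h => by simpa using h) (fun l h => by simp at h) ?_
      convert hi using 2
      · ext l; simp [E, Equiv.arrowCongr]
      · simp [E, Equiv.arrowCongr]⟩
  have hF : Function.Injective F := by
    rintro ⟨b, c⟩ ⟨b', c'⟩ h
    have h1 := E.symm.injective (congrArg Subtype.val h)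
    rw [Prod.mk.injEq] at h1
    obtain ⟨h1, h2⟩ := h1
    obtain rfl : b = b' := Subtype.ext h1
    obtain rfl : c = c' := Subtype.ext h2
    rfl
  have hcard : Nat.card S ≤ Nat.card {A : Fin (8 * k + K) → V // HasUnitMinor A} :=
    Nat.card_le_card_of_injective F hF
  have : Fintype B := Fintype.ofFinite B
  have hS : (Nat.card B : ℝ) * (0.39 * (Nat.card V : ℝ) ^ K) ≤ Nat.card S := by
    rw [Nat.card_sigma, Nat.cast_sum, Nat.card_eq_fintype_card (α := B), ← nsmul_eq_mul]
    exact Finset.card_nsmul_le_sum _ _ _ fun b _ => card_exists_isUnit_detCons_ge hq hK (hJ b)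
  set X : ℝ := (Nat.card (Fin k → V) : ℝ) with hX
  have hX0 : 0 ≤ X := by positivity
  have hB : (1 - (5 / 6) ^ 8) * X ^ 8 ≤ Nat.card B := by
    have h1 := card_not_indepModPrimes_le q k
    rw [natCard_subtype_not] at h1
    have h2 := natCard_subtype_exists (ι := Fin 8) (α := Fin k → V) IndepModPrimes
    change (Nat.card B : ℝ) = _ at h2
    rw [h2, Fintype.card_fin]
    have h3 : 0 ≤ X - Nat.card {v : Fin k → V // IndepModPrimes v} := by
      rw [hX, ← natCard_subtype_not]; positivity
    have h4 := pow_le_pow_left₀ h3 h1 8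
    rw [mul_pow] at h4
    linarith
  have hT : (Nat.card (Fin (8 * k + K) → V) : ℝ) = X ^ 8 * (Nat.card V : ℝ) ^ K := by
    rw [Nat.card_congr E, Nat.card_prod, Nat.card_fun, Nat.card_fun (α := Fin K)]
    simp [hX]
  have hY : 0 ≤ (Nat.card V : ℝ) ^ K := by positivity
  rw [hT]
  have h5 : (1 - (5 / 6) ^ 8) * X ^ 8 * (0.39 * (Nat.card V : ℝ) ^ K) ≤ Nat.card S :=
    (mul_le_mul_of_nonneg_right hB (by positivity)).trans hS
  have h6 : 0 ≤ X ^ 8 * (Nat.card V : ℝ) ^ K := by positivity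
  have h7 : (Nat.card S : ℝ) ≤ Nat.card {A : Fin (8 * k + K) → V // HasUnitMinor A} := by
    exact_mod_cast hcard
  nlinarith

lemma summable_exp_neg_pi_mul_sq {r : ℝ} (hr : 0 < r) (c : ℝ) :
    Summable fun k : ℤ => Real.exp (-Real.pi * (k - c) ^ 2 / r ^ 2) := by
  have h := summable_pow_mul_jacobiTheta₂_term_bound (|c| / r ^ 2) (T := 1 / r ^ 2)
    (by positivity) 0
  refine Summable.of_nonneg_of_le (fun _ => (Real.exp_pos _).le) (fun k => ?_) h
  rw [pow_zero, one_mul, Real.exp_le_exp]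
  have h1 : (k : ℝ) * c ≤ |(k : ℝ)| * |c| := by rw [← abs_mul]; exact le_abs_self _
  have h2 : 0 ≤ c ^ 2 := sq_nonneg c
  have h3 : 1 / r ^ 2 * (k : ℝ) ^ 2 - 2 * (|c| / r ^ 2) * |(k : ℝ)| ≤ (k - c) ^ 2 / r ^ 2 := by
    have : 1 / r ^ 2 * (k : ℝ) ^ 2 - 2 * (|c| / r ^ 2) * |(k : ℝ)| =
      (k ^ 2 - 2 * |c| * |(k : ℝ)|) / r ^ 2 := by ring
    rw [this]; gcongr; nlinarith
  push_cast
  have := mul_le_mul_of_nonneg_left h3 Real.pi_pos.le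
  have e : -Real.pi * ((k : ℝ) - c) ^ 2 / r ^ 2 = -(Real.pi * ((k - c) ^ 2 / r ^ 2)) := by ring
  rw [e]
  linarith

lemma summable_exp_neg_pi_mul_sq_mul {r : ℝ} (hr : 0 < r) :
    Summable fun k : ℤ => Real.exp (-Real.pi * r ^ 2 * k ^ 2) := by
  have := summable_exp_neg_pi_mul_sq (inv_pos.2 hr) 0
  refine this.congr fun k => ?_
  congr 1; field_simp; ring

lemma cpow_half_sq {r : ℝ} (hr : 0 < r) : (((r ^ 2 : ℝ) : ℂ)) ^ (1 / 2 : ℂ) = r := by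
  have : (1 / 2 : ℂ) = ((1 / 2 : ℝ) : ℂ) := by push_cast; rfl
  rw [this, ← Complex.ofReal_cpow (by positivity), ← Real.sqrt_eq_rpow, Real.sqrt_sq hr.le]

lemma tsum_exp_neg_pi_mul_sq_le {r : ℝ} (hr : 0 < r) (c : ℝ) :
    ∑' k : ℤ, Real.exp (-Real.pi * (k - c) ^ 2 / r ^ 2) ≤
      r * ∑' k : ℤ, Real.exp (-Real.pi * r ^ 2 * k ^ 2) := by
  have h := Complex.tsum_exp_neg_quadratic (a := ((r ^ 2 : ℝ) : ℂ))
    (by rw [Complex.ofReal_re]; positivity) (Complex.I * c)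
  rw [cpow_half_sq hr] at h
  have h1 : ∀ k : ℤ, Complex.exp (-Real.pi / ((r ^ 2 : ℝ) : ℂ) *
      (k + Complex.I * (Complex.I * c)) ^ 2) =
      ((Real.exp (-Real.pi * (k - c) ^ 2 / r ^ 2) : ℝ) : ℂ) := fun k => by
    rw [← mul_assoc, Complex.I_mul_I]
    push_cast
    congr 1; ring
  simp only [h1] at h
  rw [← Complex.ofReal_tsum] at h
  have hr' : (r : ℂ) ≠ 0 := by exact_mod_cast hr.ne'
  have h2 : ((∑' k : ℤ, Real.exp (-Real.pi * (k - c) ^ 2 / r ^ 2) : ℝ) : ℂ) =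
      r * ∑' k : ℤ, Complex.exp (-Real.pi * ((r ^ 2 : ℝ) : ℂ) * k ^ 2 +
        2 * Real.pi * (Complex.I * c) * k) := by
    rw [h]; field_simp
  have h3 : ∀ k : ℤ, ‖Complex.exp (-Real.pi * ((r ^ 2 : ℝ) : ℂ) * k ^ 2 +
        2 * Real.pi * (Complex.I * c) * k)‖ = Real.exp (-Real.pi * r ^ 2 * k ^ 2) := fun k => by
    rw [Complex.norm_exp]
    congr 1
    have : (-Real.pi * ((r ^ 2 : ℝ) : ℂ) * k ^ 2 + 2 * Real.pi * (Complex.I * c) * k) =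
      ((-Real.pi * r ^ 2 * k ^ 2 : ℝ) : ℂ) + ((2 * Real.pi * c * k : ℝ) : ℂ) * Complex.I := by
      push_cast; ring
    rw [this]; simp only [Complex.add_re, Complex.re_ofReal_mul, Complex.I_re, mul_zero, add_zero,
      Complex.ofReal_re]
  have h4 := congrArg norm h2
  rw [Complex.norm_real, Real.norm_of_nonneg (tsum_nonneg fun _ => (Real.exp_pos _).le),
    norm_mul, Complex.norm_real, Real.norm_of_nonneg hr.le] at h4
  rw [h4]
  gcongr
  have hs : Summable fun k : ℤ => ‖Complex.exp (-Real.pi * ((r ^ 2 : ℝ) : ℂ) * k ^ 2 +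
        2 * Real.pi * (Complex.I * c) * k)‖ := by
    simp only [h3]; exact summable_exp_neg_pi_mul_sq_mul hr
  refine (norm_tsum_le_tsum_norm hs).trans ?_
  simp only [h3]
  exact le_rfl

lemma tsum_exp_neg_pi_mul_sq_zero {r : ℝ} (hr : 0 < r) :
    ∑' k : ℤ, Real.exp (-Real.pi * (k - 0) ^ 2 / r ^ 2) =
      r * ∑' k : ℤ, Real.exp (-Real.pi * r ^ 2 * k ^ 2) := by
  have h := Real.tsum_exp_neg_mul_int_sq (a := r ^ 2) (by positivity)
  rw [← Real.sqrt_eq_rpow, Real.sqrt_sq hr.le] at h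
  rw [h, ← mul_assoc, mul_one_div_cancel hr.ne', one_mul]
  refine tsum_congr fun k => ?_
  congr 1; ring

lemma le_tsum_exp_neg_pi_mul_sq {r : ℝ} (hr : 0 < r) :
    r ≤ ∑' k : ℤ, Real.exp (-Real.pi * (k - 0) ^ 2 / r ^ 2) := by
  rw [tsum_exp_neg_pi_mul_sq_zero hr]
  refine le_mul_of_one_le_right hr.le ?_
  have := (summable_exp_neg_pi_mul_sq_mul hr).le_tsum 0 (fun _ _ => (Real.exp_pos _).le)
  simpa using this

lemma tsum_exp_neg_pi_sq_mul_le {r : ℝ} (hr : 0 < r) :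
    ∑' k : ℤ, Real.exp (-Real.pi * r ^ 2 * k ^ 2) ≤
      1 + 2 * (Real.exp (-Real.pi * r ^ 2) / (1 - Real.exp (-Real.pi * r ^ 2))) := by
  set t := Real.exp (-Real.pi * r ^ 2) with ht
  have hpos : 0 < Real.pi * r ^ 2 := by positivity
  have ht0 : 0 < t := Real.exp_pos _
  have ht1 : t < 1 := by rw [ht, Real.exp_lt_one_iff]; linarith
  rw [tsum_int_eq_zero_add_two_mul_tsum_pnat (fun k => by push_cast; rw [neg_sq])
    (summable_exp_neg_pi_mul_sq_mul hr)]
  have h0 : Real.exp (-Real.pi * r ^ 2 * ((0 : ℤ) : ℝ) ^ 2) = 1 := by simp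
  rw [h0, nsmul_eq_mul, tsum_pnat_eq_tsum_succ (f := fun n : ℕ =>
    Real.exp (-Real.pi * r ^ 2 * ((n : ℤ) : ℝ) ^ 2))]
  have hg : HasSum (fun n : ℕ => t * t ^ n) (t * (1 - t)⁻¹) :=
    (hasSum_geometric_of_lt_one ht0.le ht1).mul_left t
  have hle : ∀ n : ℕ, Real.exp (-Real.pi * r ^ 2 * (((n + 1 : ℕ) : ℤ) : ℝ) ^ 2) ≤ t * t ^ n := by
    intro n
    rw [← pow_succ', ht, ← Real.exp_nat_mul, Real.exp_le_exp]
    push_cast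
    have hn : (0 : ℝ) ≤ n := by positivity
    have : 0 ≤ Real.pi * r ^ 2 * (((n : ℝ) + 1) * n) := by positivity
    nlinarith
  have hsum : Summable fun n : ℕ => Real.exp (-Real.pi * r ^ 2 * (((n + 1 : ℕ) : ℤ) : ℝ) ^ 2) :=
    Summable.of_nonneg_of_le (fun _ => (Real.exp_pos _).le) hle hg.summable
  have := hsum.tsum_le_tsum hle hg.summable
  rw [hg.tsum_eq] at this
  push_cast at this ⊢
  rw [div_eq_mul_inv]
  linarith

/-- Above the smoothing parameter all Gaussian sums over translates of `ℤ` are nearly equal. -/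
lemma tsum_exp_neg_pi_mul_sq_le_of_smoothing {n : ℕ} (hn : 1 ≤ n) {r ε : ℝ} (hr : 0 < r)
    (hε : 0 < ε) (h : Real.sqrt (Real.log (2 * n * (1 + 1 / ε)) / Real.pi) ≤ r) (c : ℝ) :
    ∑' k : ℤ, Real.exp (-Real.pi * (k - c) ^ 2 / r ^ 2) ≤ r * (1 + ε / n) := by
  refine (tsum_exp_neg_pi_mul_sq_le hr c).trans ?_
  gcongr
  refine (tsum_exp_neg_pi_sq_mul_le hr).trans ?_
  have hn1 : (1 : ℝ) ≤ n := by exact_mod_cast hn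
  have hn0 : (0 : ℝ) < n := by linarith
  set T := 2 * (n : ℝ) * (1 + 1 / ε) with hT
  have hT1 : 2 * n / ε ≤ T - 1 := by
    have : T = 2 * n + 2 * n / ε := by rw [hT]; ring
    linarith
  have hT0 : 0 < T - 1 := lt_of_lt_of_le (by positivity) hT1
  have h1 : Real.log T ≤ Real.pi * r ^ 2 := by
    rw [Real.sqrt_le_left hr.le, div_le_iff₀ Real.pi_pos] at h; linarith
  have h2 : Real.exp (-Real.pi * r ^ 2) ≤ T⁻¹ := by
    rw [neg_mul, Real.exp_neg]
    apply inv_anti₀ (by linarith)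
    rwa [← Real.log_le_iff_le_exp (by linarith)]
  have hTi : T⁻¹ < 1 := inv_lt_one_of_one_lt₀ (by linarith)
  have h3 : Real.exp (-Real.pi * r ^ 2) / (1 - Real.exp (-Real.pi * r ^ 2)) ≤
      T⁻¹ / (1 - T⁻¹) := by
    apply div_le_div₀ _ h2 (by linarith) (by linarith)
    have : 0 < T := by linarith
    positivity
  have h4 : T⁻¹ / (1 - T⁻¹) = 1 / (T - 1) := by
    have : T ≠ 0 := by linarith
    field_simp
  have h5 : 1 / (T - 1) ≤ 1 / (2 * n / ε) := one_div_le_one_div_of_le (by positivity) hT1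
  have h6 : 2 * (1 / (2 * n / ε)) = ε / n := by field_simp
  linarith

/-- The Gaussian weights of parameter `r` centred at `c` on `ℤ`. -/
def gaussWeight (r c : ℝ) (k : ℤ) : ENNReal :=
  ENNReal.ofReal (Real.exp (-Real.pi * (k - c) ^ 2 / r ^ 2))

/-- The discrete Gaussian distribution on `ℤ` with parameter `r` and centre `c`. -/
def discGauss (r c : ℝ) : Measure ℤ :=
  (∑' k, gaussWeight r c k)⁻¹ • Measure.count.withDensity (gaussWeight r c)

lemma tsum_gaussWeight {r : ℝ} (hr : 0 < r) (c : ℝ) :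
    ∑' k, gaussWeight r c k =
      ENNReal.ofReal (∑' k : ℤ, Real.exp (-Real.pi * (k - c) ^ 2 / r ^ 2)) :=
  (ENNReal.ofReal_tsum_of_nonneg (fun _ => (Real.exp_pos _).le)
    (summable_exp_neg_pi_mul_sq hr c)).symm

lemma tsum_gaussWeight_ne_top {r : ℝ} (hr : 0 < r) (c : ℝ) : ∑' k, gaussWeight r c k ≠ ⊤ := by
  rw [tsum_gaussWeight hr]; exact ENNReal.ofReal_ne_top

lemma gaussWeight_ne_zero (r c : ℝ) (k : ℤ) : gaussWeight r c k ≠ 0 := by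
  rw [gaussWeight, Ne, ENNReal.ofReal_eq_zero, not_le]; exact Real.exp_pos _

lemma tsum_gaussWeight_ne_zero (r c : ℝ) : ∑' k, gaussWeight r c k ≠ 0 := by
  rw [Ne, ENNReal.tsum_eq_zero, not_forall]; exact ⟨0, gaussWeight_ne_zero r c 0⟩

lemma discGauss_singleton (r c : ℝ) (k : ℤ) :
    discGauss r c {k} = (∑' k, gaussWeight r c k)⁻¹ * gaussWeight r c k := by
  simp [discGauss]

lemma isProbabilityMeasure_discGauss {r : ℝ} (hr : 0 < r) (c : ℝ) :
    IsProbabilityMeasure (discGauss r c) := by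
  constructor
  rw [discGauss, Measure.smul_apply, withDensity_apply _ MeasurableSet.univ,
    Measure.restrict_univ, lintegral_count, smul_eq_mul,
    ENNReal.inv_mul_cancel (tsum_gaussWeight_ne_zero r c) (tsum_gaussWeight_ne_top hr c)]

lemma discGauss_add_intCast (r c : ℝ) (j : ℤ) :
    discGauss r (c + j) = (discGauss r c).map (· + j) := by
  have hw : ∀ k, gaussWeight r (c + j) k = gaussWeight r c (k - j) := fun k => by
    rw [gaussWeight, gaussWeight]; push_cast; congr 5; ring
  refine Measure.ext_of_singleton fun k => ?_
  rw [Measure.map_apply (measurable_of_countable _) (measurableSet_singleton _)]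
  have : (fun x => x + j) ⁻¹' {k} = {k - j} := by
    ext x; exact (eq_sub_iff_add_eq (a := x)).symm
  rw [this, discGauss_singleton, discGauss_singleton, hw]
  congr 2
  simp only [hw]
  exact (Equiv.subRight j).tsum_eq (gaussWeight r c)

lemma measurable_of_measurable_singleton {α β : Type*} [MeasurableSpace α] [MeasurableSpace β]
    [Countable β] [MeasurableSingletonClass β] {f : α → Measure β}
    (hf : ∀ b, Measurable fun a => f a {b}) : Measurable f := by
  refine Measure.measurable_of_measurable_coe _ fun s _ => ?_
  have : ∀ a, f a s = ∑' b : s, f a {(b : β)} := fun a => by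
    rw [← Measure.tsum_indicator_apply_singleton _ _ s.to_countable.measurableSet, tsum_subtype s
      (fun b => f a {b})]
  simp only [this]
  exact Measurable.tsum fun b => hf b

lemma measurable_discGauss (r : ℝ) : Measurable (discGauss r) := by
  refine measurable_of_measurable_singleton fun k => ?_
  simp only [discGauss_singleton]
  have : ∀ k, Measurable fun c => gaussWeight r c k := fun k => by
    unfold gaussWeight; fun_prop
  exact (Measurable.tsum this).inv.mul (this k)

lemma contGauss_eq_withDensity {α : ℝ} (hα : 0 < α) :
    contGauss α = volume.withDensity fun e =>
      ENNReal.ofReal (α⁻¹ * Real.exp (-Real.pi * e ^ 2 / α ^ 2)) := by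
  have hv : 0 < α ^ 2 / (2 * Real.pi) := by positivity
  rw [contGauss, gaussianReal_of_var_ne_zero _ (by simpa using hv)]
  congr 1
  ext e
  rw [gaussianPDF, gaussianPDFReal, Real.coe_toNNReal _ hv.le]
  have h1 : Real.sqrt (2 * Real.pi * (α ^ 2 / (2 * Real.pi))) = α := by
    rw [mul_div_cancel₀ _ (by positivity), Real.sqrt_sq hα.le]
  rw [h1]
  congr 3
  field_simp
  ring

lemma lintegral_exp_neg_pi_mul_sq {a : ℝ} (ha : 0 < a) (μ : ℝ) :
    ∫⁻ e, ENNReal.ofReal (a⁻¹ * Real.exp (-Real.pi * (e - μ) ^ 2 / a ^ 2)) = 1 := by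
  have hv : 0 < a ^ 2 / (2 * Real.pi) := by positivity
  rw [← lintegral_gaussianPDF_eq_one μ (v := (a ^ 2 / (2 * Real.pi)).toNNReal) (by simpa using hv)]
  congr 1
  ext e
  rw [gaussianPDF, gaussianPDFReal, Real.coe_toNNReal _ hv.le]
  have h1 : Real.sqrt (2 * Real.pi * (a ^ 2 / (2 * Real.pi))) = a := by
    rw [mul_div_cancel₀ _ (by positivity), Real.sqrt_sq ha.le]
  rw [h1]
  congr 3
  field_simp

/-- Averaging Gaussian weights over a continuous Gaussian choice of the centre. -/
lemma lintegral_gaussWeight_contGauss {α s q : ℝ} (hα : 0 < α) (hs : 0 < s) (hq : 0 < q) (k : ℤ) :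
    ∫⁻ e, gaussWeight (q * s) (q * e) k ∂contGauss α =
      ENNReal.ofReal (s / Real.sqrt (α ^ 2 + s ^ 2)) *
        gaussWeight (q * Real.sqrt (α ^ 2 + s ^ 2)) 0 k := by
  have hβ : 0 < α ^ 2 + s ^ 2 := by positivity
  set β := Real.sqrt (α ^ 2 + s ^ 2) with hβdef
  have hβ2 : β ^ 2 = α ^ 2 + s ^ 2 := Real.sq_sqrt hβ.le
  have hβ0 : 0 < β := Real.sqrt_pos.2 hβ
  have ha : 0 < s * α / β := by positivity
  rw [contGauss_eq_withDensity hα, lintegral_withDensity_eq_lintegral_mul _ (by fun_prop)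
    (by unfold gaussWeight; fun_prop)]
  set μ := k * α ^ 2 / (q * β ^ 2) with hμ
  have key : ∀ e : ℝ, ENNReal.ofReal (α⁻¹ * Real.exp (-Real.pi * e ^ 2 / α ^ 2)) *
      gaussWeight (q * s) (q * e) k =
      ENNReal.ofReal (s / β) * gaussWeight (q * β) 0 k *
        ENNReal.ofReal ((s * α / β)⁻¹ *
          Real.exp (-Real.pi * (e - μ) ^ 2 / (s * α / β) ^ 2)) := fun e => by
    rw [gaussWeight, gaussWeight, ← ENNReal.ofReal_mul (by positivity),
      ← ENNReal.ofReal_mul (by positivity), ← ENNReal.ofReal_mul (by positivity)]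
    congr 1
    have h1 : α⁻¹ * Real.exp (-Real.pi * e ^ 2 / α ^ 2) *
        Real.exp (-Real.pi * (k - q * e) ^ 2 / (q * s) ^ 2) =
        α⁻¹ * Real.exp (-Real.pi * e ^ 2 / α ^ 2 +
          -Real.pi * (k - q * e) ^ 2 / (q * s) ^ 2) := by
      rw [Real.exp_add]; ring
    have h2 : s / β * Real.exp (-Real.pi * (k - 0) ^ 2 / (q * β) ^ 2) *
        ((s * α / β)⁻¹ * Real.exp (-Real.pi * (e - μ) ^ 2 / (s * α / β) ^ 2)) =
        α⁻¹ * Real.exp (-Real.pi * (k - 0) ^ 2 / (q * β) ^ 2 +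
          -Real.pi * (e - μ) ^ 2 / (s * α / β) ^ 2) := by
      rw [Real.exp_add]; field_simp
    rw [h1, h2]
    congr 2
    have h3 : -Real.pi * e ^ 2 / α ^ 2 + -Real.pi * (k - q * e) ^ 2 / (q * s) ^ 2 =
        -Real.pi * ((β ^ 2 - α ^ 2) * (e * q) ^ 2 + α ^ 2 * (k - q * e) ^ 2) /
          (q ^ 2 * s ^ 2 * α ^ 2) := by
      rw [show β ^ 2 - α ^ 2 = s ^ 2 by rw [hβ2]; ring]
      field_simp
      ring
    have h4 : -Real.pi * (k - 0) ^ 2 / (q * β) ^ 2 +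
          -Real.pi * (e - μ) ^ 2 / (s * α / β) ^ 2 =
        -Real.pi * ((β ^ 2 - α ^ 2) * α ^ 2 * k ^ 2 + (e * q * β ^ 2 - k * α ^ 2) ^ 2) /
          (q ^ 2 * s ^ 2 * α ^ 2 * β ^ 2) := by
      rw [show β ^ 2 - α ^ 2 = s ^ 2 by rw [hβ2]; ring, hμ]
      field_simp
      ring
    rw [h3, h4]
    field_simp
    ring
  simp only [Pi.mul_apply, key]
  rw [lintegral_const_mul _ (by fun_prop), lintegral_exp_neg_pi_mul_sq ha, mul_one]

/-- The discrete Gaussian is dominated by the randomized rounding of a continuous Gaussian. -/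
theorem discGauss_singleton_le {n : ℕ} (hn : 1 ≤ n) {α s q ε : ℝ} (hα : 0 < α) (hs : 0 < s)
    (hq : 0 < q) (hε : 0 < ε)
    (h : Real.sqrt (Real.log (2 * n * (1 + 1 / ε)) / Real.pi) ≤ q * s) (k : ℤ) :
    discGauss (q * Real.sqrt (α ^ 2 + s ^ 2)) 0 {k} ≤
      ENNReal.ofReal (1 + ε / n) *
        (contGauss α).bind (fun e => discGauss (q * s) (q * e)) {k} := by
  have hβ : 0 < Real.sqrt (α ^ 2 + s ^ 2) := Real.sqrt_pos.2 (by positivity)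
  have hqs : 0 < q * s := by positivity
  have hδ : 0 < 1 + ε / n := by positivity
  have hmeas : Measurable fun e => discGauss (q * s) (q * e) :=
    (measurable_discGauss _).comp (measurable_id.const_mul q)
  rw [Measure.bind_apply (measurableSet_singleton k) hmeas.aemeasurable, discGauss_singleton]
  simp only [discGauss_singleton]
  set W := gaussWeight (q * Real.sqrt (α ^ 2 + s ^ 2)) 0 k with hW
  have h1 : (ENNReal.ofReal (q * s * (1 + ε / n)))⁻¹ *
      ∫⁻ e, gaussWeight (q * s) (q * e) k ∂contGauss α ≤
      ∫⁻ e, (∑' k, gaussWeight (q * s) (q * e) k)⁻¹ * gaussWeight (q * s) (q * e) k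
        ∂contGauss α := by
    rw [← lintegral_const_mul _ (by unfold gaussWeight; fun_prop)]
    refine lintegral_mono fun e => ?_
    gcongr
    rw [tsum_gaussWeight hqs]
    exact ENNReal.ofReal_le_ofReal (tsum_exp_neg_pi_mul_sq_le_of_smoothing hn hqs hε h _)
  rw [lintegral_gaussWeight_contGauss hα hs hq] at h1
  refine le_trans ?_ (mul_le_mul_right h1 _)
  have h2 : (∑' k, gaussWeight (q * Real.sqrt (α ^ 2 + s ^ 2)) 0 k)⁻¹ ≤
      (ENNReal.ofReal (q * Real.sqrt (α ^ 2 + s ^ 2)))⁻¹ := by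
    rw [ENNReal.inv_le_inv, tsum_gaussWeight (by positivity)]
    exact ENNReal.ofReal_le_ofReal (le_tsum_exp_neg_pi_mul_sq (by positivity))
  rw [← mul_assoc, ← mul_assoc, ← hW]
  gcongr
  refine h2.trans (le_of_eq ?_)
  rw [← ENNReal.ofReal_inv_of_pos (by positivity), ← ENNReal.ofReal_inv_of_pos (by positivity),
    ← ENNReal.ofReal_mul (by positivity), ← ENNReal.ofReal_mul (by positivity)]
  congr 1
  field_simp

lemma abs_integral_sub_integral_le {X : Type*} [MeasurableSpace X] {μ ν : Measure X}
    [IsProbabilityMeasure μ] [IsProbabilityMeasure ν] {ε : ℝ} (hε : 0 ≤ ε) (hε1 : ε ≤ 1)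
    (h : ENNReal.ofReal (1 - ε) • μ ≤ ν) {g : X → ℝ} (hg : IsDistinguisher g) :
    |(∫ x, g x ∂μ) - ∫ x, g x ∂ν| ≤ ε := by
  have key : ∀ g : X → ℝ, IsDistinguisher g → (∫ x, g x ∂μ) - ∫ x, g x ∂ν ≤ ε := by
    intro g hg
    have hint : ∀ (ρ : Measure X) [IsProbabilityMeasure ρ], Integrable g ρ := fun ρ _ =>
      Integrable.of_bound hg.1.aestronglyMeasurable 1 (ae_of_all _ fun x => by
        rw [Real.norm_of_nonneg (hg.2 x).1]; exact (hg.2 x).2)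
    have h1 := integral_mono_measure h (ae_of_all _ fun x => (hg.2 x).1) (hint ν)
    rw [integral_smul_measure, ENNReal.toReal_ofReal (by linarith), smul_eq_mul] at h1
    have h2 : ∫ x, g x ∂μ ≤ ∫ _, (1 : ℝ) ∂μ :=
      integral_mono (hint μ) (integrable_const _) fun x => (hg.2 x).2
    simp only [integral_const, probReal_univ, smul_eq_mul, mul_one] at h2
    nlinarith
  rw [abs_sub_le_iff]
  refine ⟨key g hg, ?_⟩
  have h3 := key (fun x => 1 - g x) ⟨measurable_const.sub hg.1, fun x =>
    ⟨by linarith [(hg.2 x).2], by linarith [(hg.2 x).1]⟩⟩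
  have hint : ∀ (ρ : Measure X) [IsProbabilityMeasure ρ], Integrable g ρ := fun ρ _ =>
      Integrable.of_bound hg.1.aestronglyMeasurable 1 (ae_of_all _ fun x => by
        rw [Real.norm_of_nonneg (hg.2 x).1]; exact (hg.2 x).2)
  rw [integral_sub (integrable_const _) (hint μ), integral_sub (integrable_const _) (hint ν)] at h3
  simp only [integral_const, probReal_univ, smul_eq_mul, mul_one] at h3
  linarith

lemma one_sub_mul_one_add_div_pow_le {n : ℕ} (hn : 1 ≤ n) {ε : ℝ} (hε : 0 ≤ ε) :
    (1 - ε) * (1 + ε / n) ^ n ≤ 1 := by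
  have hn0 : (0 : ℝ) < n := by exact_mod_cast hn
  have h1 : (1 + ε / n) ^ n ≤ Real.exp ε := by
    calc (1 + ε / n) ^ n ≤ Real.exp (ε / n) ^ n := by
          gcongr
          linarith [Real.add_one_le_exp (ε / n)]
      _ = Real.exp ε := by rw [← Real.exp_nat_mul]; congr 1; field_simp
  have h2 : 1 - ε ≤ Real.exp (-ε) := by linarith [Real.add_one_le_exp (-ε)]
  calc (1 - ε) * (1 + ε / n) ^ n ≤ Real.exp (-ε) * Real.exp ε :=
        mul_le_mul h2 h1 (by positivity) (Real.exp_pos _).le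
    _ = 1 := by rw [← Real.exp_add]; simp

lemma measure_le_of_singleton_le {α : Type*} [MeasurableSpace α] [Countable α]
    [MeasurableSingletonClass α] {μ ν : Measure α} (h : ∀ a, μ {a} ≤ ν {a}) : μ ≤ ν := by
  refine Measure.le_iff.2 fun s hs => ?_
  rw [← Measure.tsum_indicator_apply_singleton μ _ hs,
    ← Measure.tsum_indicator_apply_singleton ν _ hs]
  exact ENNReal.tsum_le_tsum fun a => Set.indicator_le_indicator (h a)

lemma smul_pi_le_pi {n : ℕ} (hn : 1 ≤ n) {ε : ℝ} (hε : 0 ≤ ε) (hε1 : ε ≤ 1) {μ ν : Measure ℤ}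
    [IsProbabilityMeasure μ] [IsProbabilityMeasure ν]
    (h : ∀ k, μ {k} ≤ ENNReal.ofReal (1 + ε / n) * ν {k}) :
    ENNReal.ofReal (1 - ε) • Measure.pi (fun _ : Fin n => μ) ≤ Measure.pi fun _ : Fin n => ν := by
  refine measure_le_of_singleton_le fun x => ?_
  rw [Measure.smul_apply, Measure.pi_singleton, Measure.pi_singleton, smul_eq_mul]
  calc ENNReal.ofReal (1 - ε) * ∏ i, μ {x i}
      ≤ ENNReal.ofReal (1 - ε) * ∏ i, (ENNReal.ofReal (1 + ε / n) * ν {x i}) := by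
        gcongr with i; exact h _
    _ = ENNReal.ofReal ((1 - ε) * (1 + ε / n) ^ n) * ∏ i, ν {x i} := by
        rw [Finset.prod_mul_distrib, Finset.prod_const, Finset.card_univ, Fintype.card_fin,
          ENNReal.ofReal_mul (by linarith), ENNReal.ofReal_pow (by positivity), mul_assoc]
    _ ≤ 1 * ∏ i, ν {x i} := by
        gcongr
        rw [ENNReal.ofReal_le_one]
        exact one_sub_mul_one_add_div_pow_le hn hε
    _ = _ := one_mul _

lemma toMeasure_eq_pi_discGauss {n : ℕ} {𝒟 : PMF (Fin n → ℤ)} {r : ℝ} (hr : 0 < r)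
    (h𝒟 : IsDiscreteGaussian 𝒟 r) :
    𝒟.toMeasure = Measure.pi fun _ : Fin n => discGauss r 0 := by
  have := isProbabilityMeasure_discGauss hr 0
  set π := Measure.pi fun _ : Fin n => discGauss r 0 with hπ
  have hprod : ∀ x : Fin n → ℤ, π {x} = (∑' k, gaussWeight r 0 k)⁻¹ ^ n *
      ENNReal.ofReal (Real.exp (-Real.pi * inorm x ^ 2 / r ^ 2)) := fun x => by
    rw [hπ, Measure.pi_singleton]
    simp only [discGauss_singleton]
    rw [Finset.prod_mul_distrib, Finset.prod_const, Finset.card_univ, Fintype.card_fin]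
    congr 1
    unfold gaussWeight
    rw [← ENNReal.ofReal_prod_of_nonneg fun _ _ => (Real.exp_pos _).le, ← Real.exp_sum, inorm,
      Real.sq_sqrt (by positivity)]
    congr 2
    rw [← Finset.sum_div, ← Finset.mul_sum]
    simp
  have hcross : ∀ x y, 𝒟 x * π {y} = 𝒟 y * π {x} := fun x y => by
    have h1 := congrArg ENNReal.ofReal (h𝒟 x y)
    rw [ENNReal.ofReal_mul (by positivity), ENNReal.ofReal_mul (by positivity),
      ENNReal.ofReal_toReal (𝒟.apply_ne_top _), ENNReal.ofReal_toReal (𝒟.apply_ne_top _)] at h1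
    rw [hprod, hprod, mul_left_comm, h1, mul_left_comm]
  refine Measure.ext_of_singleton fun x => ?_
  rw [PMF.toMeasure_apply_singleton _ _ (measurableSet_singleton x)]
  have hsum : ∑' y, π {y} = 1 := by
    rw [← measure_univ (μ := π), ← Measure.tsum_indicator_apply_singleton π _ MeasurableSet.univ]
    simp
  have h2 : ∑' y, 𝒟 x * π {y} = ∑' y, 𝒟 y * π {x} := tsum_congr (hcross x)
  rw [ENNReal.tsum_mul_left, ENNReal.tsum_mul_right, hsum, 𝒟.tsum_coe, mul_one, one_mul] at h2
  exact h2

lemma map_pi_comp_injective {ι κ X : Type*} [Fintype ι] [Fintype κ] [MeasurableSpace X]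
    (μ : Measure X) [IsProbabilityMeasure μ] {σ : κ → ι} (hσ : Function.Injective σ) :
    (Measure.pi fun _ : ι => μ).map (fun x k => x (σ k)) = Measure.pi fun _ : κ => μ := by
  have h := iIndepFun_pi (μ := fun _ : ι => μ) (X := fun _ : ι => (id : X → X))
    fun _ => measurable_id.aemeasurable
  have h' := (iIndepFun_iff_map_fun_eq_pi_map
    fun i => (measurable_pi_apply (σ i)).aemeasurable).1 (h.precomp hσ)
  refine h'.trans ?_
  congr 1
  ext1 i
  exact (measurePreserving_eval (fun _ : ι => μ) (σ i)).map_eq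

lemma lintegral_pi_add {X : Type*} [MeasurableSpace X] (μ : Measure X) [IsProbabilityMeasure μ]
    {N m : ℕ} {F : (Fin (N + m) → X) → ENNReal} (hF : Measurable F) :
    ∫⁻ x, F x ∂Measure.pi (fun _ : Fin (N + m) => μ) =
      ∫⁻ p, F (Fin.append p.1 p.2)
        ∂(Measure.pi fun _ : Fin N => μ).prod (Measure.pi fun _ : Fin m => μ) := by
  have hm : Measurable fun p : (Fin N → X) × (Fin m → X) => Fin.append p.1 p.2 := by
    refine measurable_pi_iff.2 fun i => ?_
    refine Fin.addCases (fun i => ?_) (fun i => ?_) i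
    · simp only [Fin.append_left]; fun_prop
    · simp only [Fin.append_right]; fun_prop
  rw [← lintegral_map hF hm]
  congr 1
  refine Measure.pi_eq fun s hs => ?_
  rw [Measure.map_apply hm (MeasurableSet.univ_pi hs)]
  have : (fun p : (Fin N → X) × (Fin m → X) => Fin.append p.1 p.2) ⁻¹' Set.univ.pi s =
      (Set.univ.pi fun i => s (Fin.castAdd m i)) ×ˢ (Set.univ.pi fun i => s (Fin.natAdd N i)) := by
    ext p
    simp only [Set.mem_preimage, Set.mem_univ_pi, Set.mem_prod]
    refine ⟨fun h => ⟨fun i => ?_, fun i => ?_⟩, fun h i => ?_⟩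
    · simpa using h (Fin.castAdd m i)
    · simpa using h (Fin.natAdd N i)
    · refine Fin.addCases (fun i => ?_) (fun i => ?_) i
      · simpa using h.1 i
      · simpa using h.2 i
  rw [this, Measure.prod_prod, Measure.pi_pi, Measure.pi_pi, Fin.prod_univ_add]

lemma lintegral_pi_prod {ι X : Type*} [Fintype ι] [MeasurableSpace X] (μ : Measure X)
    [IsProbabilityMeasure μ] {φ : ι → X → ENNReal} (hφ : ∀ i, Measurable (φ i)) :
    ∫⁻ x, ∏ i, φ i (x i) ∂Measure.pi (fun _ : ι => μ) = ∏ i, ∫⁻ x, φ i x ∂μ := by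
  have h := iIndepFun_pi (μ := fun _ : ι => μ) fun i => (hφ i).aemeasurable
  rw [lintegral_prod_eq_prod_lintegral_of_indepFun Finset.univ _ h
    fun i => (hφ i).comp (measurable_pi_apply i)]
  refine Finset.prod_congr rfl fun i _ => ?_
  exact (measurePreserving_eval (fun _ : ι => μ) i).lintegral_comp (hφ i)

/-- Apply the kernel `κ` to the first `N` samples, and then, depending on the outcome, apply a
transformation to the remaining samples. -/
def twoStage {X W Y : Type*} [MeasurableSpace X] [Fintype W] [MeasurableSpace W]
    [MeasurableSpace Y] {N m : ℕ} (κ : Kernel X W)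
    (η : (Fin N → W) → Kernel (Fin m → X) Y) (x : Fin (N + m) → X) : Measure Y :=
  ∑ w : Fin N → W, (∏ i, κ (x (Fin.castAdd m i)) {w i}) • η w fun i => x (Fin.natAdd N i)

section TwoStage

variable {X W Y : Type*} [MeasurableSpace X] [Fintype W] [MeasurableSpace W]
  [MeasurableSingletonClass W] [MeasurableSpace Y] {N m : ℕ} (κ : Kernel X W)
  (η : (Fin N → W) → Kernel (Fin m → X) Y)

lemma measurable_twoStage : Measurable (twoStage κ η) := by
  refine Measure.measurable_of_measurable_coe _ fun s hs => ?_
  simp only [twoStage, Measure.finsetSum_apply, Measure.smul_apply, smul_eq_mul]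
  refine Finset.measurable_fun_sum _ fun w _ => Measurable.mul ?_ ?_
  · refine Finset.measurable_fun_prod _ fun i _ => ?_
    exact (Kernel.measurable_coe κ (measurableSet_singleton _)).comp (measurable_pi_apply _)
  · exact (Kernel.measurable_coe (η w) hs).comp (by fun_prop)

lemma isProbabilityMeasure_twoStage [IsMarkovKernel κ] [∀ w, IsMarkovKernel (η w)]
    (x : Fin (N + m) → X) : IsProbabilityMeasure (twoStage κ η x) := by
  constructor
  simp only [twoStage, Measure.finsetSum_apply, Measure.smul_apply, smul_eq_mul, measure_univ,
    mul_one]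
  classical
  rw [← Fintype.piFinset_univ, ← Finset.prod_univ_sum (fun _ => Finset.univ)
    (fun i w => κ (x (Fin.castAdd m i)) {w})]
  refine Finset.prod_eq_one fun i _ => ?_
  rw [← measure_univ (μ := κ (x (Fin.castAdd m i))), ← lintegral_one, lintegral_fintype]
  simp

/-- On independent samples, the kernel in `twoStage` acts on the marginal distribution. -/
lemma lintegral_bind_twoStage (ν : Measure X) [IsProbabilityMeasure ν] [IsMarkovKernel κ]
    {g : Y → ENNReal} (hg : Measurable g) :
    ∫⁻ y, g y ∂(Measure.pi fun _ : Fin (N + m) => ν).bind (twoStage κ η) =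
      ∫⁻ w, (∫⁻ y, g y ∂(Measure.pi fun _ : Fin m => ν).bind (η w))
        ∂Measure.pi fun _ : Fin N => ν.bind κ := by
  have : IsProbabilityMeasure (ν.bind κ) :=
    ⟨by simp [Measure.bind_apply MeasurableSet.univ κ.measurable.aemeasurable]⟩
  have hη : ∀ w, Measurable fun y : Fin m → X => ∫⁻ z, g z ∂η w y := fun w =>
    hg.lintegral_kernel
  have hφ : ∀ (w : Fin N → W) (i : Fin N), Measurable fun x : X => κ x {w i} := fun w i =>
    Kernel.measurable_coe κ (measurableSet_singleton _)
  rw [Measure.lintegral_bind (measurable_twoStage κ η).aemeasurable hg.aemeasurable,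
    lintegral_fintype (α := Fin N → W)]
  simp only [twoStage, lintegral_finsetSum_measure, lintegral_smul_measure, smul_eq_mul]
  have hterm : ∀ w : Fin N → W, Measurable fun x : Fin (N + m) → X =>
      (∏ i, κ (x (Fin.castAdd m i)) {w i}) * ∫⁻ y, g y ∂η w fun i => x (Fin.natAdd N i) :=
    fun w => (Finset.measurable_fun_prod _ fun i _ =>
      (hφ w i).comp (measurable_pi_apply _)).mul ((hη w).comp (by fun_prop))
  rw [lintegral_finsetSum _ fun w _ => hterm w]
  refine Finset.sum_congr rfl fun w _ => ?_
  rw [lintegral_pi_add ν (hterm w)]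
  simp only [Fin.append_left, Fin.append_right]
  rw [lintegral_prod_mul (f := fun y : Fin N → X => ∏ i, κ (y i) {w i})
    (g := fun y : Fin m → X => ∫⁻ z, g z ∂η w y)
    (Finset.measurable_fun_prod _ fun i _ =>
      (hφ w i).comp (measurable_pi_apply _)).aemeasurable (hη w).aemeasurable,
    lintegral_pi_prod ν (hφ w), mul_comm, Measure.pi_singleton,
    Measure.lintegral_bind (η w).measurable.aemeasurable hg.aemeasurable]
  congr 1
  refine Finset.prod_congr rfl fun i _ => ?_
  rw [Measure.bind_apply (measurableSet_singleton _) κ.measurable.aemeasurable]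

end TwoStage

lemma map_uniformOfFintype_equiv {V : Type*} [Fintype V] [Nonempty V] [MeasurableSpace V]
    [DiscreteMeasurableSpace V] (e : V ≃ V) :
    (PMF.uniformOfFintype V).toMeasure.map e = (PMF.uniformOfFintype V).toMeasure := by
  refine Measure.ext_of_singleton fun a => ?_
  rw [Measure.map_apply (measurable_of_countable _) (measurableSet_singleton _)]
  have : e ⁻¹' {a} = {e.symm a} := by ext; simp [Equiv.eq_symm_apply]
  rw [this, PMF.toMeasure_apply_singleton _ _ (measurableSet_singleton _),
    PMF.toMeasure_apply_singleton _ _ (measurableSet_singleton _)]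
  simp

/-- Randomized rounding of `b ∈ 𝕋` to `T_q`, by a discrete Gaussian of parameter `r / q`. -/
def torusRound (q : ℕ) (r : ℝ) (b : 𝕋) : Measure (ZMod q) :=
  (discGauss r (q * (AddCircle.measurableEquivIco 1 0 b : ℝ))).map Int.cast

lemma measurable_torusRound (q : ℕ) (r : ℝ) : Measurable (torusRound q r) := by
  refine (Measure.measurable_map _ (measurable_of_countable _)).comp
    ((measurable_discGauss r).comp ?_)
  exact ((AddCircle.measurableEquivIco 1 0).measurable.subtype_val).const_mul _

lemma isProbabilityMeasure_torusRound (q : ℕ) {r : ℝ} (hr : 0 < r) (b : 𝕋) :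
    IsProbabilityMeasure (torusRound q r b) := by
  have := isProbabilityMeasure_discGauss hr (q * (AddCircle.measurableEquivIco 1 0 b : ℝ))
  exact Measure.isProbabilityMeasure_map (measurable_of_countable _).aemeasurable

lemma torusRound_coe (q : ℕ) (r t : ℝ) :
    torusRound q r (t : 𝕋) = (discGauss r (q * t)).map Int.cast := by
  obtain ⟨j, hj⟩ : ∃ j : ℤ, (AddCircle.measurableEquivIco 1 0 (t : 𝕋) : ℝ) = t + j := by
    refine ⟨-⌊t⌋, ?_⟩
    rw [AddCircle.measurableEquivIco]
    change ((AddCircle.equivIco 1 0 (t : 𝕋) : Set.Ico (0 : ℝ) (0 + 1)) : ℝ) = _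
    rw [AddCircle.coe_equivIco_mk_apply]
    rw [div_one, mul_one, Int.fract]
    push_cast
    ring
  rw [torusRound, hj, mul_add]
  have : (q : ℝ) * j = ((q * j : ℤ) : ℝ) := by push_cast; rfl
  rw [this, discGauss_add_intCast, Measure.map_map (measurable_of_countable _)
    (measurable_of_countable _)]
  congr 1
  ext k
  simp

lemma torusRound_toT_add {q : ℕ} [NeZero q] (r : ℝ) (x : ZMod q) (e : ℝ) :
    torusRound q r (toT x + (e : 𝕋)) =
      (discGauss r (q * e)).map fun k : ℤ => x + (k : ZMod q) := by
  have hq : (q : ℝ) ≠ 0 := NeZero.ne _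
  rw [toT, ZMod.toAddCircle_apply, ← AddCircle.coe_add, torusRound_coe]
  have : (q : ℝ) * (x.val / q + e) = q * e + ((x.val : ℤ) : ℝ) := by
    push_cast; field_simp; ring
  rw [this, discGauss_add_intCast, Measure.map_map (measurable_of_countable _)
    (measurable_of_countable _)]
  congr 1
  ext k
  simp [add_comm]

/-- Round the second component of a sample. -/
def sampleRound (n q : ℕ) [NeZero q] (r : ℝ) :
    Kernel (Samp n q) ((Fin n → ZMod q) × ZMod q) where
  toFun x := (torusRound q r x.2).map fun b => (x.1, b)
  measurable' := measurable_from_prod_countable_right fun a => by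
    exact (Measure.measurable_map (fun b => (a, b)) (measurable_of_countable _)).comp
      (measurable_torusRound q r)

lemma sampleRound_apply (n q : ℕ) [NeZero q] (r : ℝ) (x : Samp n q) :
    sampleRound n q r x = (torusRound q r x.2).map fun b => (x.1, b) := rfl

lemma isMarkovKernel_sampleRound (n q : ℕ) [NeZero q] {r : ℝ} (hr : 0 < r) :
    IsMarkovKernel (sampleRound n q r) := by
  refine ⟨fun x => ?_⟩
  have := isProbabilityMeasure_torusRound q hr x.2
  rw [sampleRound_apply]
  exact Measure.isProbabilityMeasure_map (measurable_of_countable _).aemeasurable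

lemma measurable_lweA_map (n q : ℕ) [NeZero q] (sec : Fin n → ZMod q) :
    Measurable fun ae : (Fin n → ZMod q) × ℝ =>
      (ae.1, toT (∑ j, ae.1 j * sec j) + ((ae.2 : ℝ) : 𝕋)) := by
  refine measurable_from_prod_countable_right fun a => ?_
  have h : Measurable fun e : ℝ => (e : 𝕋) := AddCircle.measurable_mk'
  exact measurable_const.prodMk (h.const_add (toT (∑ j, a j * sec j)))

instance isProbabilityMeasure_lweA (n q : ℕ) [NeZero q] (sec : Fin n → ZMod q) (φ : Measure ℝ)
    [IsProbabilityMeasure φ] : IsProbabilityMeasure (lweA n q sec φ) :=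
  Measure.isProbabilityMeasure_map (measurable_lweA_map n q sec).aemeasurable

instance isProbabilityMeasure_uniT : IsProbabilityMeasure uniT :=
  ⟨by simp [uniT, AddCircle.measure_univ]⟩

instance isProbabilityMeasure_uniSamp (n q : ℕ) [NeZero q] :
    IsProbabilityMeasure (uniSamp n q) :=
  inferInstanceAs (IsProbabilityMeasure (((PMF.uniformOfFintype _).toMeasure).prod uniT))

lemma lweA_bind_sampleRound (n q : ℕ) [NeZero q] (r : ℝ) (hr : 0 < r) (sec : Fin n → ZMod q)
    (φ : Measure ℝ) [IsProbabilityMeasure φ] :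
    (lweA n q sec φ).bind (sampleRound n q r) =
      ((PMF.uniformOfFintype (Fin n → ZMod q)).toMeasure.prod
        (φ.bind fun e => discGauss r (q * e))).map
        fun ak => (ak.1, ∑ j, ak.1 j * sec j + (ak.2 : ZMod q)) := by
  have hd : Measurable fun e : ℝ => discGauss r (q * e) :=
    (measurable_discGauss r).comp (measurable_const_mul _)
  have hp : IsProbabilityMeasure (φ.bind fun e => discGauss r (q * e)) := by
    constructor
    rw [Measure.bind_apply MeasurableSet.univ hd.aemeasurable]
    simp [(isProbabilityMeasure_discGauss hr _).measure_univ]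
  have := isMarkovKernel_sampleRound n q hr
  refine Measure.ext_of_lintegral _ fun g hg => ?_
  have hg' : Measurable fun x => ∫⁻ y, g y ∂sampleRound n q r x := hg.lintegral_kernel
  rw [Measure.lintegral_bind (Kernel.measurable _).aemeasurable hg.aemeasurable, lweA,
    lintegral_map hg' (measurable_lweA_map n q sec),
    lintegral_map hg (measurable_of_countable _),
    lintegral_prod _ (Measurable.aemeasurable
      (by exact hg'.comp (measurable_lweA_map n q sec))),
    lintegral_prod _ (measurable_of_countable _).aemeasurable]
  refine lintegral_congr fun a => ?_
  rw [Measure.lintegral_bind hd.aemeasurable (measurable_of_countable _).aemeasurable]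
  refine lintegral_congr fun e => ?_
  rw [sampleRound_apply, torusRound_toT_add, lintegral_map hg (measurable_of_countable _),
    lintegral_map (measurable_of_countable _) (measurable_of_countable _)]

/-- The change of variables `a ↦ -(M⁻¹)ᵀ a` on `T_qⁿ`, for invertible `M`. -/
def negInvTranspose {n q : ℕ} (M : Matrix (Fin n) (Fin n) (ZMod q)) (hM : IsUnit M.det) :
    (Fin n → ZMod q) ≃ (Fin n → ZMod q) where
  toFun a := -(M⁻¹.transpose.mulVec a)
  invFun a := -(M.transpose.mulVec a)
  left_inv a := by
    dsimp only
    rw [Matrix.mulVec_neg, neg_neg, Matrix.mulVec_mulVec, ← Matrix.transpose_mul,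
      Matrix.nonsing_inv_mul _ hM, Matrix.transpose_one, Matrix.one_mulVec]
  right_inv a := by
    dsimp only
    rw [Matrix.mulVec_neg, neg_neg, Matrix.mulVec_mulVec, ← Matrix.transpose_mul,
      Matrix.mul_nonsing_inv _ hM, Matrix.transpose_one, Matrix.one_mulVec]

/-- The map turning LWE samples with secret `sec` into LWE samples with secret
`z - M sec`. -/
def changeSecret {n q : ℕ} [NeZero q] (M : Matrix (Fin n) (Fin n) (ZMod q)) (hM : IsUnit M.det)
    (z : Fin n → ZMod q) (x : Samp n q) : Samp n q :=
  (negInvTranspose M hM x.1, x.2 + toT (∑ j, negInvTranspose M hM x.1 j * z j))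

section ChangeSecret

variable {n q : ℕ} [NeZero q] (M : Matrix (Fin n) (Fin n) (ZMod q)) (hM : IsUnit M.det)
  (z : Fin n → ZMod q)

lemma measurable_changeSecret : Measurable (changeSecret M hM z) := by
  refine measurable_from_prod_countable_right fun a => ?_
  have h : Measurable fun b : 𝕋 => b := measurable_id
  exact (measurable_const (a := negInvTranspose M hM a)).prodMk
    (h.add_const (toT (∑ j, negInvTranspose M hM a j * z j)))

lemma lintegral_uniform_negInvTranspose (F : (Fin n → ZMod q) → ENNReal) :
    ∫⁻ a, F (negInvTranspose M hM a) ∂(PMF.uniformOfFintype (Fin n → ZMod q)).toMeasure =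
      ∫⁻ a, F a ∂(PMF.uniformOfFintype (Fin n → ZMod q)).toMeasure := by
  rw [← lintegral_map (measurable_of_countable F) (measurable_of_countable _),
    map_uniformOfFintype_equiv]

lemma toT_add_changeSecret (sec a : Fin n → ZMod q) :
    toT (∑ j, a j * sec j) + toT (∑ j, negInvTranspose M hM a j * z j) =
      toT (∑ j, negInvTranspose M hM a j * (z - M.mulVec sec) j) := by
  rw [toT, toT, toT, ← map_add]
  congr 1
  change dotProduct a sec + dotProduct _ z = dotProduct _ (z - M.mulVec sec)
  have h : a = -(M.transpose.mulVec (negInvTranspose M hM a)) :=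
    ((negInvTranspose M hM).symm_apply_apply a).symm
  have h' : dotProduct a sec = -dotProduct (negInvTranspose M hM a) (M.mulVec sec) := by
    conv_lhs => rw [h]
    rw [neg_dotProduct, Matrix.mulVec_transpose, Matrix.dotProduct_mulVec]
  rw [h', dotProduct_sub]
  ring

lemma map_changeSecret_lweA (sec : Fin n → ZMod q) (φ : Measure ℝ) [IsProbabilityMeasure φ] :
    (lweA n q sec φ).map (changeSecret M hM z) = lweA n q (z - M.mulVec sec) φ := by
  refine Measure.ext_of_lintegral _ fun g hg => ?_
  have hg' : Measurable fun x => g (changeSecret M hM z x) :=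
    hg.comp (measurable_changeSecret M hM z)
  rw [lintegral_map hg (measurable_changeSecret M hM z), lweA, lweA,
    lintegral_map hg' (measurable_lweA_map n q sec), lintegral_map hg (measurable_lweA_map n q _),
    lintegral_prod _ (Measurable.aemeasurable (by exact hg'.comp (measurable_lweA_map n q sec))),
    lintegral_prod _ (Measurable.aemeasurable (by exact hg.comp (measurable_lweA_map n q _)))]
  refine Eq.trans ?_ (lintegral_uniform_negInvTranspose M hM _)
  refine lintegral_congr fun a => lintegral_congr fun e => ?_
  rw [← toT_add_changeSecret, changeSecret, add_right_comm]

lemma map_changeSecret_uniSamp :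
    (uniSamp n q).map (changeSecret M hM z) = uniSamp n q := by
  refine Measure.ext_of_lintegral _ fun g hg => ?_
  have hg' : Measurable fun x => g (changeSecret M hM z x) :=
    hg.comp (measurable_changeSecret M hM z)
  rw [lintegral_map hg (measurable_changeSecret M hM z), uniSamp,
    lintegral_prod _ hg'.aemeasurable, lintegral_prod _ hg.aemeasurable]
  refine Eq.trans ?_ (lintegral_uniform_negInvTranspose M hM _)
  refine lintegral_congr fun a => ?_
  exact lintegral_add_right_eq_self (μ := (volume : Measure 𝕋))
    (fun b => g (negInvTranspose M hM a, b))
    (toT (∑ j, negInvTranspose M hM a j * z j))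

end ChangeSecret

open Classical in
/-- Given the rounded samples `w`, transform samples using an invertible square subsystem of `w`
if there is one, and output uniform samples otherwise. -/
def normalize {n q N : ℕ} [NeZero q] (m : ℕ) (w : Fin N → (Fin n → ZMod q) × ZMod q) :
    Kernel (Fin m → Samp n q) (Fin m → Samp n q) :=
  if h : HasUnitMinor fun i => (w i).1 then
    Kernel.deterministic
      (fun Y i => changeSecret _ h.choose_spec.2 (fun k => (w (h.choose k)).2) (Y i))
      (measurable_pi_iff.2 fun i =>
        (measurable_changeSecret _ _ _).comp (measurable_pi_apply i))
  else Kernel.const _ (uniSamples n m q)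

instance isProbabilityMeasure_uniSamples (n m q : ℕ) [NeZero q] :
    IsProbabilityMeasure (uniSamples n m q) :=
  inferInstanceAs (IsProbabilityMeasure (Measure.pi fun _ : Fin m => uniSamp n q))

instance isProbabilityMeasure_lweSamples (n m q : ℕ) [NeZero q] (sec : Fin n → ZMod q)
    (φ : Measure ℝ) [IsProbabilityMeasure φ] : IsProbabilityMeasure (lweSamples n m q sec φ) :=
  inferInstanceAs (IsProbabilityMeasure (Measure.pi fun _ : Fin m => lweA n q sec φ))

instance isMarkovKernel_normalize {n q N : ℕ} [NeZero q] (m : ℕ)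
    (w : Fin N → (Fin n → ZMod q) × ZMod q) : IsMarkovKernel (normalize m w) := by
  unfold normalize
  split_ifs <;> infer_instance

lemma uniSamples_bind_normalize {n q N : ℕ} [NeZero q] (m : ℕ)
    (w : Fin N → (Fin n → ZMod q) × ZMod q) :
    (uniSamples n m q).bind (normalize m w) = uniSamples n m q := by
  unfold normalize
  split_ifs with h
  · rw [Measure.deterministic_comp_eq_map, uniSamples, Measure.pi_map_pi fun _ => (measurable_changeSecret _ _ _).aemeasurable]
    simp only [map_changeSecret_uniSamp]
  · simp

lemma lweSamples_bind_normalize_of_not {n q N : ℕ} [NeZero q] (m : ℕ)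
    {w : Fin N → (Fin n → ZMod q) × ZMod q} (h : ¬HasUnitMinor fun i => (w i).1)
    (sec : Fin n → ZMod q) (φ : Measure ℝ) [IsProbabilityMeasure φ] :
    (lweSamples n m q sec φ).bind (normalize m w) = uniSamples n m q := by
  rw [normalize, dif_neg h]
  simp

lemma lweSamples_bind_normalize {n q N : ℕ} [NeZero q] (m : ℕ)
    {a : Fin N → Fin n → ZMod q} (h : HasUnitMinor a) (sec : Fin n → ZMod q)
    (φ : Measure ℝ) [IsProbabilityMeasure φ] :
    ∃ σ : Fin n → Fin N, Function.Injective σ ∧ ∀ x : Fin N → ℤ,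
      (lweSamples n m q sec φ).bind
        (normalize m fun i => (a i, ∑ j, a i j * sec j + (x i : ZMod q))) =
      lweSamples n m q (modq q fun k => x (σ k)) φ := by
  refine ⟨h.choose, h.choose_spec.1, fun x => ?_⟩
  rw [normalize, dif_pos h, Measure.deterministic_comp_eq_map, lweSamples,
    Measure.pi_map_pi fun _ => (measurable_changeSecret _ _ _).aemeasurable]
  simp only [map_changeSecret_lweA]
  rw [lweSamples]
  congr! 3
  ext k
  simp [modq, Matrix.mulVec, dotProduct]

/-- The distribution of the rounding of an error with distribution `φ`. -/
def roundedError (q : ℕ) (r : ℝ) (φ : Measure ℝ) : Measure ℤ :=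
  φ.bind fun e => discGauss r (q * e)

lemma measurable_discGauss_mul (q : ℕ) (r : ℝ) : Measurable fun e : ℝ => discGauss r (q * e) :=
  (measurable_discGauss r).comp (measurable_const_mul _)

lemma isProbabilityMeasure_roundedError (q : ℕ) {r : ℝ} (hr : 0 < r) (φ : Measure ℝ)
    [IsProbabilityMeasure φ] : IsProbabilityMeasure (roundedError q r φ) := by
  constructor
  rw [roundedError, Measure.bind_apply MeasurableSet.univ
    (measurable_discGauss_mul q r).aemeasurable]
  simp [(isProbabilityMeasure_discGauss hr _).measure_univ]

/-- The distribution of the matrix of the vectors occurring in `N` samples. -/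
def uniMatrix (n N q : ℕ) [NeZero q] : Measure (Fin N → Fin n → ZMod q) :=
  Measure.pi fun _ => (PMF.uniformOfFintype (Fin n → ZMod q)).toMeasure

instance isProbabilityMeasure_uniMatrix (n N q : ℕ) [NeZero q] :
    IsProbabilityMeasure (uniMatrix n N q) :=
  inferInstanceAs (IsProbabilityMeasure (Measure.pi fun _ : Fin N =>
    (PMF.uniformOfFintype (Fin n → ZMod q)).toMeasure))

lemma uniMatrix_real_eq {n N q : ℕ} [NeZero q] (S : Set (Fin N → Fin n → ZMod q)) :
    (uniMatrix n N q).real S = Nat.card S / Nat.card (Fin N → Fin n → ZMod q) := by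
  classical
  have h1 : ∀ A, (uniMatrix n N q).real {A} = (Nat.card (Fin N → Fin n → ZMod q) : ℝ)⁻¹ := by
    intro A
    rw [measureReal_def, uniMatrix, Measure.pi_singleton]
    simp [PMF.toMeasure_apply_singleton _ _ (measurableSet_singleton _)]
  rw [← Set.coe_toFinset S, ← sum_measureReal_singleton]
  simp [h1, div_eq_mul_inv]

lemma quarter_le_uniMatrix_hasUnitMinor {n N q : ℕ} [NeZero q] (hq : 25 ≤ q) (hn : 1 ≤ n)
    (hN : 16 * (n : ℝ) + 4 * Real.log (Real.log q) ≤ N) :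
    1 / 4 ≤ (uniMatrix n N q).real {A | HasUnitMinor A} := by
  have h := quarter_mul_card_le_card_hasUnitMinor hq hn hN
  rw [uniMatrix_real_eq, le_div_iff₀ (by exact_mod_cast Nat.card_pos)]
  exact h

/-- The value of a test function on the transformed LWE samples. -/
lemma lintegral_lweSamples_bind_twoStage {n N m q : ℕ} [NeZero q] {r : ℝ} (hr : 0 < r)
    (sec : Fin n → ZMod q) (φ : Measure ℝ) [IsProbabilityMeasure φ]
    {g : (Fin m → Samp n q) → ENNReal} (hg : Measurable g) :
    ∫⁻ y, g y ∂(lweSamples n (N + m) q sec φ).bind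
        (twoStage (sampleRound n q r) (normalize (N := N) m)) =
      (∫⁻ y, g y ∂(Measure.pi fun _ : Fin n => roundedError q r φ).bind
          fun t => lweSamples n m q (modq q t) φ) *
        uniMatrix n N q {A | HasUnitMinor A} +
      (∫⁻ y, g y ∂uniSamples n m q) * uniMatrix n N q {A | HasUnitMinor A}ᶜ := by
  have := isMarkovKernel_sampleRound n q hr
  have := isProbabilityMeasure_roundedError q hr φ
  rw [lweSamples, lintegral_bind_twoStage _ _ _ hg, lweA_bind_sampleRound n q r hr]
  change ∫⁻ w, _ ∂(Measure.pi fun _ : Fin N => Measure.map _ (Measure.prod _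
    (roundedError q r φ))) = _
  rw [← Measure.pi_map_pi fun _ => (measurable_of_countable _).aemeasurable,
    lintegral_map (measurable_of_countable _) (measurable_of_countable _),
    ← (measurePreserving_arrowProdEquivProdArrow (Fin n → ZMod q) ℤ (Fin N) _ _).symm.map_eq,
    lintegral_map (measurable_of_countable _) (MeasurableEquiv.measurable _),
    lintegral_prod _ (measurable_of_countable _).aemeasurable]
  change ∫⁻ a, ∫⁻ x : Fin N → ℤ, ∫⁻ y, g y ∂(lweSamples n m q sec φ).bind
    (normalize m fun i => (a i, ∑ j, a i j * sec j + (x i : ZMod q))) ∂_ ∂uniMatrix n N q = _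
  rw [← lintegral_add_compl _ (MeasurableSet.of_discrete (s := {A | HasUnitMinor A}))]
  congr 1
  · rw [← setLIntegral_const]
    refine setLIntegral_congr_fun MeasurableSet.of_discrete fun a ha => ?_
    obtain ⟨σ, hσ, h⟩ := lweSamples_bind_normalize m ha sec φ
    simp only [h]
    rw [Measure.lintegral_bind (measurable_of_countable _).aemeasurable hg.aemeasurable,
      ← map_pi_comp_injective _ hσ,
      lintegral_map (measurable_of_countable _) (measurable_of_countable _)]
  · rw [← setLIntegral_const]
    refine setLIntegral_congr_fun MeasurableSet.of_discrete fun a ha => ?_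
    have h : ∀ x : Fin N → ℤ, (lweSamples n m q sec φ).bind
        (normalize m fun i => (a i, ∑ j, a i j * sec j + (x i : ZMod q))) = uniSamples n m q :=
      fun x => lweSamples_bind_normalize_of_not m (w := fun i => (a i, _)) ha sec φ
    simp [h]

lemma lintegral_uniSamples_bind_twoStage {n N m q : ℕ} [NeZero q] {r : ℝ} (hr : 0 < r)
    {g : (Fin m → Samp n q) → ENNReal} (hg : Measurable g) :
    ∫⁻ y, g y ∂(uniSamples n (N + m) q).bind
        (twoStage (sampleRound n q r) (normalize (N := N) m)) = ∫⁻ y, g y ∂uniSamples n m q := by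
  have := isMarkovKernel_sampleRound n q hr
  rw [uniSamples, lintegral_bind_twoStage _ _ _ hg]
  have : IsProbabilityMeasure ((uniSamp n q).bind (sampleRound n q r)) := by infer_instance
  have h : ∀ w : Fin N → (Fin n → ZMod q) × ZMod q,
      (Measure.pi fun _ : Fin m => uniSamp n q).bind (normalize m w) = uniSamples n m q :=
    uniSamples_bind_normalize m
  simp [h, uniSamples]

lemma integral_eq_toReal_lintegral {X : Type*} [MeasurableSpace X] {f : X → ℝ}
    (hf : IsDistinguisher f) (μ : Measure X) :
    ∫ x, f x ∂μ = (∫⁻ x, ENNReal.ofReal (f x) ∂μ).toReal :=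
  integral_eq_lintegral_of_nonneg_ae (ae_of_all _ fun x => (hf.2 x).1)
    hf.1.aestronglyMeasurable

lemma lintegral_ofReal_ne_top {X : Type*} [MeasurableSpace X] {f : X → ℝ}
    (hf : IsDistinguisher f) (μ : Measure X) [IsProbabilityMeasure μ] :
    ∫⁻ x, ENNReal.ofReal (f x) ∂μ ≠ ⊤ := by
  refine ne_top_of_le_ne_top ENNReal.one_ne_top ?_
  calc ∫⁻ x, ENNReal.ofReal (f x) ∂μ ≤ ∫⁻ _, 1 ∂μ :=
        lintegral_mono fun x => ENNReal.ofReal_le_one.2 (hf.2 x).2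
    _ = 1 := by simp

lemma isProbabilityMeasure_bind_of_forall {X Y : Type*} [MeasurableSpace X] [MeasurableSpace Y]
    (μ : Measure X) [IsProbabilityMeasure μ] {L : X → Measure Y} (hL : Measurable L)
    (h : ∀ x, IsProbabilityMeasure (L x)) : IsProbabilityMeasure (μ.bind L) := by
  constructor
  rw [Measure.bind_apply MeasurableSet.univ hL.aemeasurable]
  simp

/-- The expectation of a bounded test function is stable under replacing the discrete Gaussian
by the rounded continuous Gaussian. -/
lemma abs_integral_bind_sub_le {n q : ℕ} [NeZero q] (hn : 1 ≤ n) {α s ε : ℝ} (hα : 0 < α)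
    (hs0 : 0 < s) (hε : 0 < ε) (hε1 : ε ≤ 1)
    (hs : Real.sqrt (Real.log (2 * n * (1 + 1 / ε)) / Real.pi) ≤ q * s)
    {𝒟 : PMF (Fin n → ℤ)} (h𝒟 : IsDiscreteGaussian 𝒟 ((q : ℝ) * Real.sqrt (α ^ 2 + s ^ 2)))
    {Y : Type*} [MeasurableSpace Y] {L : (Fin n → ℤ) → Measure Y}
    (hL : ∀ t, IsProbabilityMeasure (L t)) {f : Y → ℝ} (hf : IsDistinguisher f) :
    |(∫ y, f y ∂𝒟.toMeasure.bind L) -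
      ∫ y, f y ∂(Measure.pi fun _ : Fin n => roundedError q (q * s) (contGauss α)).bind L| ≤ ε := by
  have hq : (0 : ℝ) < q := by exact_mod_cast Nat.pos_of_neZero q
  have hr : 0 < (q : ℝ) * Real.sqrt (α ^ 2 + s ^ 2) :=
    mul_pos hq (Real.sqrt_pos.2 (by positivity))
  have := isProbabilityMeasure_discGauss hr 0
  have := isProbabilityMeasure_roundedError q (mul_pos hq hs0) (contGauss α)
  have hLm : Measurable L := measurable_of_countable _
  have := isProbabilityMeasure_bind_of_forall 𝒟.toMeasure hLm hL
  have := isProbabilityMeasure_bind_of_forall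
    (Measure.pi fun _ : Fin n => roundedError q (q * s) (contGauss α)) hLm hL
  refine abs_integral_sub_integral_le hε.le hε1 ?_ hf
  have h := smul_pi_le_pi (μ := discGauss (q * Real.sqrt (α ^ 2 + s ^ 2)) 0)
    (ν := roundedError q (q * s) (contGauss α)) hn hε.le hε1 fun k =>
      discGauss_singleton_le hn hα hs0 hq hε hs k
  rw [← toMeasure_eq_pi_discGauss hr h𝒟] at h
  refine Measure.le_iff.2 fun S hS => ?_
  rw [Measure.smul_apply, Measure.bind_apply hS hLm.aemeasurable,
    Measure.bind_apply hS hLm.aemeasurable, smul_eq_mul, ← smul_eq_mul, ← lintegral_smul_measure]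
  exact lintegral_mono' h le_rfl

theorem exists_kernel_normal_form {n N m q : ℕ} [NeZero q] (hq : 25 ≤ q) (hn : 1 ≤ n)
    (hN : 16 * (n : ℝ) + 4 * Real.log (Real.log q) ≤ N)
    {α s ε : ℝ} (hα : 0 < α) (hs0 : 0 < s) (hε : 0 < ε) (hε1 : ε ≤ 1)
    (hs : Real.sqrt (Real.log (2 * n * (1 + 1 / ε)) / Real.pi) ≤ q * s)
    {𝒟 : PMF (Fin n → ℤ)}
    (h𝒟 : IsDiscreteGaussian 𝒟 ((q : ℝ) * Real.sqrt (α ^ 2 + s ^ 2))) :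
    ∃ κ : Kernel (Fin (N + m) → Samp n q) (Fin m → Samp n q), IsMarkovKernel κ ∧
      ∀ f : (Fin m → Samp n q) → ℝ, IsDistinguisher f →
        (adv f (𝒟.toMeasure.bind fun t => lweSamples n m q (modq q t) (contGauss α))
            (uniSamples n m q) - ε) / 4 ≤
          adv f
            (((PMF.uniformOfFintype (Fin n → ZMod q)).toMeasure.bind fun sec =>
                lweSamples n (N + m) q sec (contGauss α)).bind fun x => κ x)
            ((uniSamples n (N + m) q).bind fun x => κ x) := by
  have hr : 0 < (q : ℝ) * s := mul_pos (by exact_mod_cast Nat.pos_of_neZero q) hs0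
  have := isMarkovKernel_sampleRound n q hr
  have := isProbabilityMeasure_roundedError q hr (contGauss α)
  let T : (Fin (N + m) → Samp n q) → Measure (Fin m → Samp n q) :=
    twoStage (sampleRound n q (q * s)) (normalize m)
  have hT : Measurable T := measurable_twoStage _ _
  refine ⟨⟨T, hT⟩, ⟨isProbabilityMeasure_twoStage _ _⟩, fun f hf => ?_⟩
  set L : (Fin n → ℤ) → Measure (Fin m → Samp n q) :=
    fun t => lweSamples n m q (modq q t) (contGauss α) with hLdef
  have hL : ∀ t, IsProbabilityMeasure (L t) := fun t => by rw [hLdef]; infer_instance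
  have hclose := abs_integral_bind_sub_le hn hα hs0 hε hε1 hs h𝒟 hL hf
  have hp := quarter_le_uniMatrix_hasUnitMinor hq hn hN
  set p := (uniMatrix n N q).real {A | HasUnitMinor A} with hpdef
  have hg : Measurable fun y => ENNReal.ofReal (f y) := hf.1.ennreal_ofReal
  have hgT : Measurable fun x => ∫⁻ y, ENNReal.ofReal (f y) ∂T x :=
    (Measure.measurable_lintegral hg).comp hT
  have := isProbabilityMeasure_bind_of_forall
    (Measure.pi fun _ : Fin n => roundedError q (q * s) (contGauss α))
    (measurable_of_countable L) hL
  have hU : ∫ y, f y ∂(uniSamples n (N + m) q).bind T = ∫ y, f y ∂uniSamples n m q := by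
    rw [integral_eq_toReal_lintegral hf, integral_eq_toReal_lintegral hf,
      lintegral_uniSamples_bind_twoStage hr hg]
  have hLWE : ∫ y, f y ∂((PMF.uniformOfFintype (Fin n → ZMod q)).toMeasure.bind fun sec =>
        lweSamples n (N + m) q sec (contGauss α)).bind T =
      (∫ y, f y ∂(Measure.pi fun _ : Fin n => roundedError q (q * s) (contGauss α)).bind L) * p +
        (∫ y, f y ∂uniSamples n m q) * (1 - p) := by
    have hc : 1 - p = (uniMatrix n N q).real {A | HasUnitMinor A}ᶜ := by
      rw [probReal_compl_eq_one_sub MeasurableSet.of_discrete]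
    rw [hc, integral_eq_toReal_lintegral hf, integral_eq_toReal_lintegral hf,
      integral_eq_toReal_lintegral hf, hpdef, measureReal_def, measureReal_def,
      ← ENNReal.toReal_mul, ← ENNReal.toReal_mul, ← ENNReal.toReal_add
        (ENNReal.mul_ne_top (lintegral_ofReal_ne_top hf _) (measure_ne_top _ _))
        (ENNReal.mul_ne_top (lintegral_ofReal_ne_top hf _) (measure_ne_top _ _)),
      Measure.lintegral_bind hT.aemeasurable hg.aemeasurable,
      Measure.lintegral_bind (measurable_of_countable _).aemeasurable hgT.aemeasurable]
    congr 1
    have h : ∀ sec : Fin n → ZMod q,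
        ∫⁻ x, ∫⁻ y, ENNReal.ofReal (f y) ∂T x ∂lweSamples n (N + m) q sec (contGauss α) = _ :=
      fun sec => (Measure.lintegral_bind hT.aemeasurable hg.aemeasurable).symm.trans
        (lintegral_lweSamples_bind_twoStage hr sec (contGauss α) hg)
    simp only [h]
    rw [lintegral_const, measure_univ, mul_one]
  change _ ≤ |(∫ y, f y ∂Measure.bind _ T) - ∫ y, f y ∂Measure.bind _ T|
  rw [hU, hLWE, adv]
  set a := ∫ y, f y ∂𝒟.toMeasure.bind L
  set b := ∫ y, f y ∂(Measure.pi fun _ : Fin n => roundedError q (q * s) (contGauss α)).bind L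
  set u := ∫ y, f y ∂uniSamples n m q
  have e : b * p + u * (1 - p) - u = p * (b - u) := by ring
  rw [e, abs_mul, abs_of_nonneg (by linarith : 0 ≤ p)]
  have h1 : |a - u| ≤ |a - b| + |b - u| := abs_sub_le a b u
  have h2 : 1 / 4 * |b - u| ≤ p * |b - u| := by gcongr
  linarith

/-- **Lemma 2.9 (normal form of LWE).** For any `q ≥ 25`, `n, m ≥ 1`, `α > 0`,
`ε ∈ (0,1/2)` and `s ≥ √(ln(2n(1+1/ε))/π)/q`, with `m' = m − (16n + 4·ln ln q)` and
`𝒟 = D_{ℤⁿ,q(α²+s²)^{1/2}}` the discrete Gaussian on `ℤⁿ` of parameter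
`q·(α²+s²)^{1/2}`, there is a randomized transformation (a Markov kernel, possibly
aborting) mapping `m` elements of `T_qⁿ × 𝕋` to `m'` elements of `T_qⁿ × 𝕋`, such that
every distinguisher `f` with advantage `ζ` between `m'` samples of `A_{q,s',D_α}` (with
secret `s' ← 𝒟`) and `m'` uniform samples yields, by composition with the
transformation, a distinguisher with advantage at least `(ζ − 8ε)/4` between `m` samples
of `A_{q,s,D_α}` (with `s` uniform in `{0,…,q−1}ⁿ`) and `m` uniform samples. -/
theorem lwe_normal_form (n m q : ℕ) [NeZero q] (hq : 25 ≤ q) (hn : 1 ≤ n) (hm : 1 ≤ m)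
    (α s ε : ℝ) (hα : 0 < α) (hε : 0 < ε) (hε' : ε < 1 / 2)
    (hs : Real.sqrt (Real.log (2 * n * (1 + 1 / ε)) / Real.pi) / q ≤ s)
    (𝒟 : PMF (Fin n → ℤ))
    (h𝒟 : IsDiscreteGaussian 𝒟 ((q : ℝ) * Real.sqrt (α ^ 2 + s ^ 2))) :
    ∃ κ : Kernel (Fin m → Samp n q)
        (Fin (m - ⌈16 * (n : ℝ) + 4 * Real.log (Real.log q)⌉₊) → Samp n q),
      IsMarkovKernel κ ∧
      ∀ f : (Fin (m - ⌈16 * (n : ℝ) + 4 * Real.log (Real.log q)⌉₊) → Samp n q) → ℝ,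
        IsDistinguisher f →
        (adv f
            (𝒟.toMeasure.bind fun s' =>
              lweSamples n (m - ⌈16 * (n : ℝ) + 4 * Real.log (Real.log q)⌉₊) q
                (modq q s') (contGauss α))
            (uniSamples n (m - ⌈16 * (n : ℝ) + 4 * Real.log (Real.log q)⌉₊) q)
          - 8 * ε) / 4
        ≤ adv f
            (((PMF.uniformOfFintype (Fin n → ZMod q)).toMeasure.bind fun sec =>
                lweSamples n m q sec (contGauss α)).bind fun x => κ x)
            ((uniSamples n m q).bind fun x => κ x) := by
  have hq0 : (0 : ℝ) < q := by exact_mod_cast Nat.pos_of_neZero q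
  have hn1 : (1 : ℝ) ≤ n := by exact_mod_cast hn
  have hs0 : 0 < s := by
    refine lt_of_lt_of_le (div_pos (Real.sqrt_pos.2 (div_pos (Real.log_pos ?_) Real.pi_pos)) hq0) hs
    have : 0 < 1 / ε := by positivity
    nlinarith
  have hs1 : Real.sqrt (Real.log (2 * n * (1 + 1 / ε)) / Real.pi) ≤ q * s := by
    rw [div_le_iff₀ hq0] at hs
    linarith
  have hN := Nat.le_ceil (16 * (n : ℝ) + 4 * Real.log (Real.log q))
  generalize ⌈16 * (n : ℝ) + 4 * Real.log (Real.log q)⌉₊ = N at hN ⊢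
  obtain hNm | hNm := le_total N m
  · obtain ⟨k, rfl⟩ := Nat.exists_eq_add_of_le hNm
    rw [Nat.add_sub_cancel_left]
    obtain ⟨κ, hκ, h⟩ := exists_kernel_normal_form (m := k) hq hn hN hα hs0 hε
      (by linarith) hs1 h𝒟
    exact ⟨κ, hκ, fun f hf => le_trans (by linarith) (h f hf)⟩
  · rw [Nat.sub_eq_zero_of_le hNm]
    refine ⟨Kernel.const _ (uniSamples n 0 q), inferInstance, fun f hf => ?_⟩
    have := isProbabilityMeasure_bind_of_forall 𝒟.toMeasure (measurable_of_countable _)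
      fun t => isProbabilityMeasure_lweSamples n 0 q (modq q t) (contGauss α)
    have hf0 : f = fun _ => f default := funext fun x => by rw [Subsingleton.elim x default]
    refine le_trans ?_ (abs_nonneg _)
    rw [adv, hf0]
    simp only [integral_const, probReal_univ, sub_self, abs_zero]
    linarith

end LWEPaper
end
end

section
/- For any integers q ≥ 25, n ≥ 1, and reals t₁ ≥ 4, t₂ ≥ 1, the following holds: given a sequence of ⌈t₁·n + t₂·ln ln q⌉ vectors a₁, a₂, … chosen uniformly and independently from (ℤ/qℤ)ⁿ, with probability at least 1 − e^{−t₁ n/16} − e^{−t₂/4} there exists a subsequence of n of these vectors such that the n×n matrix whose columns they form is invertible modulo q. -/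
theorem log_factorial_le (N : ℕ) (hN : 1 ≤ N) :
    Real.log (N.factorial : ℝ) ≤ (N + 1) * Real.log N - N + 1 := by
  induction N, hN using Nat.le_induction with
  | base => simp
  | succ N hN ih =>
    have hN0 : (0 : ℝ) < N := by exact_mod_cast hN
    have h1 : 1 ≤ (N + 1 : ℝ) * (Real.log (N + 1) - Real.log N) := by
      have h := Real.one_sub_inv_le_log_of_pos (x := ((N : ℝ) + 1) / N) (by positivity)
      rw [Real.log_div (by positivity) (by positivity)] at h
      calc (1 : ℝ) = (N + 1 : ℝ) * (1 - (((N : ℝ) + 1) / N)⁻¹) := by field_simp; ring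
        _ ≤ _ := by gcongr
    rw [Nat.factorial_succ]
    push_cast
    rw [Real.log_mul (by positivity) (by positivity)]
    nlinarith

theorem prod_prime_pow_dvd_factorial (N : ℕ) :
    ∏ p ∈ Finset.range (N + 1) with p.Prime, p ^ (N / p) ∣ N.factorial := by
  apply Finset.prod_dvd_of_isRelPrime
  · intro p hp r hr hpr
    simp only [Finset.coe_filter, Set.mem_ofPred_eq] at hp hr
    exact Nat.coprime_iff_isRelPrime.1 (Nat.coprime_pow_primes _ _ hp.2 hr.2 hpr)
  · intro p hp
    have hp' := (Finset.mem_filter.1 hp).2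
    rw [hp'.pow_dvd_factorial_iff (b := Nat.log p N + 2) (by omega)]
    calc N / p = N / p ^ 1 := by simp
      _ ≤ _ := Finset.single_le_sum (f := fun i => N / p ^ i) (by simp) (by simp)

/-- The sum of `log p / p` over the primes `p ≤ N`. -/
noncomputable def sumLogDivPrime (N : ℕ) : ℝ :=
  ∑ p ∈ Finset.range (N + 1) with p.Prime, Real.log p / p

theorem mul_sumLogDivPrime_le (N : ℕ) :
    N * sumLogDivPrime N ≤ Real.log (N.factorial : ℝ) + N * Real.log 4 := by
  have h1 : ∑ p ∈ Finset.range (N + 1) with p.Prime, ((N / p : ℕ) : ℝ) * Real.log p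
      ≤ Real.log (N.factorial : ℝ) := by
    have hle := Nat.le_of_dvd N.factorial_pos (prod_prime_pow_dvd_factorial N)
    have hpos : 0 < ∏ p ∈ Finset.range (N + 1) with p.Prime, p ^ (N / p) :=
      Finset.prod_pos fun p hp => pow_pos (Finset.mem_filter.1 hp).2.pos _
    have h := Real.log_le_log (by exact_mod_cast hpos) (Nat.cast_le (α := ℝ).2 hle)
    push_cast at h
    rw [Real.log_prod fun p hp => pow_ne_zero _ (by
      exact_mod_cast (Finset.mem_filter.1 hp).2.ne_zero)] at h
    simpa [Real.log_pow] using h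
  have h2 : ∑ p ∈ Finset.range (N + 1) with p.Prime, Real.log p ≤ N * Real.log 4 := by
    have h := Real.log_le_log (by exact_mod_cast primorial_pos N)
      (Nat.cast_le (α := ℝ).2 (primorial_le_four_pow N))
    rw [primorial] at h
    push_cast at h
    rw [Real.log_prod fun p hp => (by
      exact_mod_cast (Finset.mem_filter.1 hp).2.ne_zero)] at h
    simpa [Real.log_pow] using h
  rw [sumLogDivPrime, Finset.mul_sum]
  refine le_trans ?_ (add_le_add h1 h2)
  rw [← Finset.sum_add_distrib]
  refine Finset.sum_le_sum fun p hp => ?_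
  have hp' := (Finset.mem_filter.1 hp).2
  have hlt : (N : ℝ) / p ≤ (N / p : ℕ) + 1 := by
    rw [← Nat.floor_div_eq_div (K := ℝ)]
    exact (Nat.lt_floor_add_one _).le
  have hlog : 0 ≤ Real.log p := Real.log_natCast_nonneg p
  calc (N : ℝ) * (Real.log p / p) = N / p * Real.log p := by ring
    _ ≤ ((N / p : ℕ) + 1) * Real.log p := by gcongr
    _ = _ := by ring

theorem log_31_gt : (3.4334 : ℝ) < Real.log 31 := by
  have h := Real.one_sub_inv_le_log_of_pos (x := (31 : ℝ) / 32) (by norm_num)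
  rw [Real.log_div (by norm_num) (by norm_num), show (32 : ℝ) = 2 ^ 5 by norm_num,
    Real.log_pow] at h
  have := Real.log_two_gt_d9
  norm_num at h
  linarith

theorem log_31_lt : Real.log 31 < 3.4345 := by
  have h := Real.log_le_sub_one_of_pos (x := (31 : ℝ) / 32) (by norm_num)
  rw [Real.log_div (by norm_num) (by norm_num), show (32 : ℝ) = 2 ^ 5 by norm_num,
    Real.log_pow] at h
  have := Real.log_two_lt_d9
  norm_num at h
  linarith

theorem sumLogDivPrime_le (N : ℕ) (hN : 31 ≤ N) :
    sumLogDivPrime N ≤ Real.log N + 0.5295 := by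
  have hN' : (31 : ℝ) ≤ N := by exact_mod_cast hN
  have h1 := mul_sumLogDivPrime_le N
  have h2 := log_factorial_le N (by omega)
  have h3 : Real.log N ≤ Real.log 31 + (N / 31 - 1) := by
    have h := Real.log_le_sub_one_of_pos (x := (N : ℝ) / 31) (by positivity)
    rw [Real.log_div (by positivity) (by norm_num)] at h
    linarith
  have h4 : Real.log 4 < 1.3863 := by
    rw [show (4 : ℝ) = 2 ^ 2 by norm_num, Real.log_pow]
    have := Real.log_two_lt_d9
    norm_num; linarith
  have := log_31_lt
  refine le_of_mul_le_mul_left (a := (N : ℝ)) ?_ (by linarith)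
  nlinarith

theorem mul_log_two_le_log {a k m : ℕ} (h : 2 ^ m ≤ a ^ k) :
    (m : ℝ) * Real.log 2 ≤ k * Real.log a := by
  rw [← Real.log_pow, ← Real.log_pow]
  exact Real.log_le_log (by positivity) (by exact_mod_cast h)

theorem sumLogDivPrime_31_gt : (2.409 : ℝ) < sumLogDivPrime 31 := by
  have e : (Finset.range (31 + 1)).filter Nat.Prime = {2, 3, 5, 7, 11, 13, 17, 19, 23, 29, 31} := by
    decide +kernel
  have h2 := Real.log_two_gt_d9
  have h3 := mul_log_two_le_log (a := 3) (k := 12) (m := 19) (by norm_num)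
  have h5 := mul_log_two_le_log (a := 5) (k := 28) (m := 65) (by norm_num)
  have h7 := mul_log_two_le_log (a := 7) (k := 5) (m := 14) (by norm_num)
  have h11 := mul_log_two_le_log (a := 11) (k := 11) (m := 38) (by norm_num)
  have h13 := mul_log_two_le_log (a := 13) (k := 10) (m := 37) (by norm_num)
  have h17 := mul_log_two_le_log (a := 17) (k := 12) (m := 49) (by norm_num)
  have h19 := mul_log_two_le_log (a := 19) (k := 17) (m := 72) (by norm_num)
  have h23 := mul_log_two_le_log (a := 23) (k := 2) (m := 9) (by norm_num)
  have h29 := mul_log_two_le_log (a := 29) (k := 7) (m := 34) (by norm_num)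
  have h31 := log_31_gt
  rw [sumLogDivPrime, e]
  norm_num at *
  linarith

/-- The product of `1 - 1 / p` over the primes `p ≤ N`. -/
noncomputable def primeProd (N : ℕ) : ℝ :=
  ∏ p ∈ Finset.range (N + 1) with p.Prime, (1 - (p : ℝ)⁻¹)

theorem exp_neg_le_one_sub_inv {x : ℝ} (hx : 1 < x) : Real.exp (-(1 / (x - 1))) ≤ 1 - x⁻¹ := by
  have h := Real.add_one_le_exp (1 / (x - 1))
  rw [Real.exp_neg]
  have h1 : 0 < x - 1 := by linarith
  have : 1 - x⁻¹ = (1 / (x - 1) + 1)⁻¹ := by field_simp; ring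
  rw [this]
  gcongr

theorem primeProd_pos (N : ℕ) : 0 < primeProd N :=
  Finset.prod_pos fun p hp => by
    have : (1 : ℝ) < p := by exact_mod_cast (Finset.mem_filter.1 hp).2.one_lt
    have := inv_lt_one_of_one_lt₀ this
    linarith

theorem primeProd_31 : (0.15278 : ℝ) < primeProd 31 := by
  have e : (Finset.range (31 + 1)).filter Nat.Prime = {2, 3, 5, 7, 11, 13, 17, 19, 23, 29, 31} := by
    decide +kernel
  rw [primeProd, e]
  norm_num

theorem neg_log_primeProd_31_le :
    -Real.log (primeProd 31) - Real.log (Real.log 31) ≤ Real.log 4 - 0.739 := by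
  have h1 := primeProd_31
  have h2 := log_31_gt
  have h3 : Real.log (1 / (4 * (primeProd 31 * Real.log 31))) ≤ -0.739 := by
    have h4 : 1 / (4 * (primeProd 31 * Real.log 31)) ≤ 0.4767 := by
      rw [div_le_iff₀ (by positivity)]
      nlinarith
    have h5 := Real.log_le_sub_one_of_pos (x := (0.9534 : ℝ)) (by norm_num)
    have h6 : Real.log 0.4767 = Real.log 0.9534 - Real.log 2 := by
      rw [← Real.log_div (by norm_num) (by norm_num)]; norm_num
    have h7 := Real.log_two_gt_d9
    have := Real.log_le_log (by positivity) h4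
    norm_num at *
    linarith
  rw [one_div, Real.log_inv, Real.log_mul (by norm_num) (by positivity),
    Real.log_mul (by positivity) (by positivity)] at h3
  linarith

theorem neg_log_primeProd_le (N : ℕ) (hN : 31 ≤ N) :
    -Real.log (primeProd N) ≤ (sumLogDivPrime N - 0.5295) / Real.log N + Real.log (Real.log N)
      + (Real.log 4 - 1.2537) - 1 / N := by
  induction N, hN using Nat.le_induction with
  | base =>
    have h1 := neg_log_primeProd_31_le
    have h2 := sumLogDivPrime_31_gt
    have h3 := log_31_gt
    have h4 := log_31_lt
    have h5 : (0.5471 : ℝ) ≤ (sumLogDivPrime 31 - 0.5295) / Real.log 31 := by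
      rw [le_div_iff₀ (by positivity)]; nlinarith
    norm_num at *
    linarith
  | succ N hN ih =>
    have hN' : (31 : ℝ) ≤ N := by exact_mod_cast hN
    have hl : 0 < Real.log N := Real.log_pos (by linarith)
    have hll : Real.log N ≤ Real.log (N + 1) := Real.log_le_log (by linarith) (by linarith)
    have hl' : 0 < Real.log (N + 1) := by linarith
    have hA := sumLogDivPrime_le N hN
    have key : (sumLogDivPrime N - 0.5295) / Real.log N + Real.log (Real.log N)
        ≤ (sumLogDivPrime N - 0.5295) / Real.log (N + 1) + Real.log (Real.log (N + 1)) := by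
      have h1 := Real.one_sub_inv_le_log_of_pos (x := Real.log (N + 1) / Real.log N) (by positivity)
      rw [Real.log_div (by positivity) (by positivity), inv_div] at h1
      have h2 : (sumLogDivPrime N - 0.5295) * (1 / Real.log N - 1 / Real.log (N + 1))
          ≤ Real.log N * (1 / Real.log N - 1 / Real.log (N + 1)) := by
        gcongr
        · rw [sub_nonneg]; gcongr
        · linarith
      have h3 : Real.log N * (1 / Real.log N - 1 / Real.log (N + 1))
          = 1 - Real.log N / Real.log (N + 1) := by field_simp
      have h4 : (sumLogDivPrime N - 0.5295) * (1 / Real.log N - 1 / Real.log (N + 1))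
          = (sumLogDivPrime N - 0.5295) / Real.log N
            - (sumLogDivPrime N - 0.5295) / Real.log (N + 1) := by ring
      linarith
    have hinv : (1 : ℝ) / (N + 1) ≤ 1 / N := by gcongr; linarith
    by_cases hp : (N + 1).Prime
    · have e1 : sumLogDivPrime (N + 1) = sumLogDivPrime N + Real.log (N + 1) / (N + 1) := by
        rw [sumLogDivPrime, Finset.range_add_one, Finset.filter_insert, if_pos hp,
          Finset.sum_insert (by simp), sumLogDivPrime]
        push_cast; ring
      have e2 : primeProd (N + 1) = (1 - ((N : ℝ) + 1)⁻¹) * primeProd N := by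
        rw [primeProd, Finset.range_add_one, Finset.filter_insert, if_pos hp,
          Finset.prod_insert (by simp), primeProd]
        push_cast; ring
      have h5 := exp_neg_le_one_sub_inv (x := (N : ℝ) + 1) (by linarith)
      have h6 := Real.log_le_log (Real.exp_pos _) h5
      rw [Real.log_exp, add_sub_cancel_right] at h6
      have h7 : 0 < 1 - ((N : ℝ) + 1)⁻¹ := lt_of_lt_of_le (Real.exp_pos _) h5
      rw [e1, e2, Real.log_mul h7.ne' (primeProd_pos N).ne']
      push_cast
      have h8 : (sumLogDivPrime N + Real.log (N + 1) / (N + 1) - 0.5295) / Real.log (N + 1)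
          = (sumLogDivPrime N - 0.5295) / Real.log (N + 1) + 1 / (N + 1) := by
        field_simp; ring
      rw [h8]
      linarith
    · have e1 : sumLogDivPrime (N + 1) = sumLogDivPrime N := by
        rw [sumLogDivPrime, Finset.range_add_one, Finset.filter_insert, if_neg hp, sumLogDivPrime]
      have e2 : primeProd (N + 1) = primeProd N := by
        rw [primeProd, Finset.range_add_one, Finset.filter_insert, if_neg hp, primeProd]
      rw [e1, e2]
      push_cast
      linarith

theorem primeProd_mul_exp_le (q N : ℕ) (hq : q ≠ 0) (hN : 1 ≤ N) :
    primeProd N * Real.exp (-(Real.log q / (N * Real.log (N + 1))))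
      ≤ ∏ p ∈ q.primeFactors, (1 - (p : ℝ)⁻¹) := by
  have hN0 : (1 : ℝ) ≤ N := by exact_mod_cast hN
  have hlogN : 0 < Real.log (N + 1) := Real.log_pos (by linarith)
  have hpr : ∀ p : ℕ, p.Prime → 0 ≤ 1 - (p : ℝ)⁻¹ ∧ 1 - (p : ℝ)⁻¹ ≤ 1 := fun p hp => by
    have : (1 : ℝ) < p := by exact_mod_cast hp.one_lt
    have := inv_lt_one_of_one_lt₀ this
    have : 0 < (p : ℝ)⁻¹ := by positivity
    constructor <;> linarith
  rw [← Finset.prod_filter_mul_prod_filter_not q.primeFactors (fun p => p ≤ N)]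
  gcongr ?_ * ?_
  · exact Finset.prod_nonneg fun p hp =>
      (hpr p (Nat.prime_of_mem_primeFactors (Finset.mem_filter.1 hp).1)).1
  · rw [primeProd]
    refine Finset.prod_le_prod_of_subset_of_le_one ?_ ?_ ?_
    · intro p hp
      simp only [Finset.mem_filter, Finset.mem_range] at hp ⊢
      exact ⟨by omega, Nat.prime_of_mem_primeFactors hp.1⟩
    · intro p hp; exact (hpr p (Finset.mem_filter.1 hp).2).1
    · intro p hp _; exact (hpr p (Finset.mem_filter.1 hp).2).2
  · have hsum : ∑ p ∈ q.primeFactors with ¬ p ≤ N, Real.log p ≤ Real.log q := by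
      calc ∑ p ∈ q.primeFactors with ¬ p ≤ N, Real.log p
          ≤ ∑ p ∈ q.primeFactors, Real.log p :=
            Finset.sum_le_sum_of_subset_of_nonneg (Finset.filter_subset _ _)
              fun p _ _ => Real.log_natCast_nonneg p
        _ = Real.log ((∏ p ∈ q.primeFactors, p : ℕ) : ℝ) := by
            push_cast
            rw [Real.log_prod fun p hp => by
              exact_mod_cast (Nat.prime_of_mem_primeFactors hp).ne_zero]
        _ ≤ Real.log q := by
            refine Real.log_le_log ?_ ?_
            · exact_mod_cast Finset.prod_pos fun p hp => (Nat.prime_of_mem_primeFactors hp).pos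
            · exact_mod_cast Nat.le_of_dvd (Nat.pos_of_ne_zero hq) (Nat.prod_primeFactors_dvd q)
    calc Real.exp (-(Real.log q / (N * Real.log (N + 1))))
        ≤ Real.exp (∑ p ∈ q.primeFactors with ¬ p ≤ N,
            -(Real.log p / (N * Real.log (N + 1)))) := by
          rw [Finset.sum_neg_distrib, ← Finset.sum_div]
          gcongr
      _ = ∏ p ∈ q.primeFactors with ¬ p ≤ N,
            Real.exp (-(Real.log p / (N * Real.log (N + 1)))) := Real.exp_sum _ _
      _ ≤ _ := by
          refine Finset.prod_le_prod (fun _ _ => (Real.exp_pos _).le) fun p hp => ?_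
          obtain ⟨_, hlt⟩ := Finset.mem_filter.1 hp
          have hlt' : (N : ℝ) + 1 ≤ p := by exact_mod_cast not_le.1 hlt
          refine le_trans ?_ (exp_neg_le_one_sub_inv (by linarith))
          have : Real.log (N + 1) ≤ Real.log p := Real.log_le_log (by linarith) hlt'
          have hp1 : 0 < (p : ℝ) - 1 := by linarith
          refine Real.exp_le_exp.2 (neg_le_neg ?_)
          rw [div_le_div_iff₀ hp1 (by positivity)]
          nlinarith

theorem exp_le_inv_one_sub_pow {x : ℝ} (hx : x < 64) :
    Real.exp x ≤ ((1 - x / 64)⁻¹) ^ 64 := by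
  have h := Real.one_sub_le_exp_neg (x / 64)
  have h0 : 0 < 1 - x / 64 := by linarith
  have h1 : Real.exp (x / 64) ≤ (1 - x / 64)⁻¹ := by
    rw [Real.exp_neg] at h
    exact (le_inv_comm₀ h0 (Real.exp_pos _)).1 h
  calc Real.exp x = Real.exp (x / 64) ^ 64 := by rw [← Real.exp_nat_mul]; congr 1; push_cast; ring
    _ ≤ _ := by gcongr

theorem one_div_four_log_le_of_mem_interval {q N : ℕ} {a b P u v : ℝ} (hq : q ≠ 0) (hN : 1 ≤ N)
    (ha : 1 < a) (hqa : a ≤ Real.log q) (hqb : Real.log q ≤ b) (hP : P ≤ primeProd N)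
    (hu0 : 0 < u) (hu : u ≤ Real.log (N + 1)) (hv0 : 0 < v) (hv : v ≤ Real.log a)
    (hb64 : b / (N * u) < 64) (h : ((1 - b / (N * u) / 64)⁻¹) ^ 64 ≤ 4 * P * v) :
    1 / (4 * Real.log (Real.log q)) ≤ ∏ p ∈ q.primeFactors, (1 - (p : ℝ)⁻¹) := by
  have hN0 : (1 : ℝ) ≤ N := by exact_mod_cast hN
  have hv' : v ≤ Real.log (Real.log q) := hv.trans (Real.log_le_log (by linarith) hqa)
  refine le_trans ?_ (primeProd_mul_exp_le q N hq hN)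
  have h1 : Real.log q / (N * Real.log (N + 1)) ≤ b / (N * u) := by
    have : 0 ≤ b := by linarith
    gcongr
  have h2 : Real.exp (Real.log q / (N * Real.log (N + 1))) ≤ 4 * P * v :=
    (Real.exp_le_exp.2 h1).trans ((exp_le_inv_one_sub_pow hb64).trans h)
  have hv1 : 0 < Real.log (Real.log q) := by linarith
  rw [Real.exp_neg, ← div_eq_mul_inv, div_le_div_iff₀ (by positivity) (Real.exp_pos _), one_mul]
  refine h2.trans ?_
  calc 4 * P * v = P * (4 * v) := by ring
    _ ≤ _ := by gcongr; exact (primeProd_pos N).le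

theorem one_div_four_log_le_of_large {q : ℕ} (hq : q ≠ 0) (h : 100 ≤ Real.log q) :
    1 / (4 * Real.log (Real.log q)) ≤ ∏ p ∈ q.primeFactors, (1 - (p : ℝ)⁻¹) := by
  set l := Real.log q with hl
  set N := ⌊l⌋₊ with hNdef
  have hN : 100 ≤ N := Nat.le_floor (by exact_mod_cast h)
  have hN' : (100 : ℝ) ≤ N := by exact_mod_cast hN
  have hNl : (N : ℝ) ≤ l := Nat.floor_le (by linarith)
  have hlN : l ≤ N + 1 := (Nat.lt_floor_add_one l).le
  have hL4 : 4 ≤ Real.log l := by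
    rw [Real.le_log_iff_exp_le (by linarith)]
    calc Real.exp 4 = Real.exp 1 ^ 4 := by rw [← Real.exp_nat_mul]; norm_num
      _ ≤ 3 ^ 4 := by gcongr; exact Real.exp_one_lt_three.le
      _ ≤ l := by linarith
  have hlogN : 0 < Real.log N := Real.log_pos (by linarith)
  have hloglog : Real.log (Real.log N) ≤ Real.log (Real.log l) :=
    Real.log_le_log hlogN (Real.log_le_log (by linarith) hNl)
  refine le_trans ?_ (primeProd_mul_exp_le q N hq (by omega))
  rw [← hl]
  have h1 := neg_log_primeProd_le N (by omega)
  have h2 := sumLogDivPrime_le N (by omega)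
  have h3 : (sumLogDivPrime N - 0.5295) / Real.log N ≤ 1 := by
    rw [div_le_one hlogN]; linarith
  have h4 : l / (N * Real.log (N + 1)) ≤ 0.2525 := by
    have : 4 ≤ Real.log ((N : ℝ) + 1) := hL4.trans (Real.log_le_log (by linarith) hlN)
    rw [div_le_iff₀ (by positivity)]
    nlinarith
  have h5 : 0 ≤ (1 : ℝ) / N := by positivity
  have h6 : 1 / (4 * Real.log l) = Real.exp (-(Real.log 4 + Real.log (Real.log l))) := by
    rw [Real.exp_neg, Real.exp_add, Real.exp_log (by norm_num), Real.exp_log (by linarith), one_div]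
  rw [h6]
  rw [← Real.exp_log (primeProd_pos N), ← Real.exp_add]
  refine Real.exp_le_exp.2 ?_
  linarith

theorem primeProd_10 : (0.22857 : ℝ) < primeProd 10 := by
  have e : (Finset.range (10 + 1)).filter Nat.Prime = {2, 3, 5, 7} := by decide +kernel
  rw [primeProd, e]
  norm_num

theorem primeProd_36 : (0.15278 : ℝ) < primeProd 36 := by
  have e : (Finset.range (36 + 1)).filter Nat.Prime = {2, 3, 5, 7, 11, 13, 17, 19, 23, 29, 31} := by
    decide +kernel
  rw [primeProd, e]
  norm_num

theorem totient_lower_bound_of_lt_55 : ∀ q < 55, 25 ≤ q → q * 4 ≤ Nat.totient q * 15 := by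
  decide +kernel

theorem one_le_log_log {x : ℝ} (hx : 16 ≤ x) : 1 ≤ Real.log (Real.log x) := by
  have h1 := Real.exp_one_lt_d9
  have h2 := Real.log_two_gt_d9
  have h3 : Real.log 16 = 4 * Real.log 2 := by
    rw [show (16 : ℝ) = 2 ^ 4 by norm_num, Real.log_pow]; norm_num
  have h4 : Real.log 16 ≤ Real.log x := Real.log_le_log (by norm_num) hx
  rw [Real.le_log_iff_exp_le (by linarith)]
  linarith

theorem one_div_four_log_le (q : ℕ) (hq : 25 ≤ q) :
    1 / (4 * Real.log (Real.log q)) ≤ ∏ p ∈ q.primeFactors, (1 - (p : ℝ)⁻¹) := by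
  have hq0 : q ≠ 0 := by omega
  have h2 := Real.log_two_gt_d9
  have h2' := Real.log_two_lt_d9
  have hlog4 : Real.log 4 = 2 * Real.log 2 := by
    rw [show (4 : ℝ) = 2 ^ 2 by norm_num, Real.log_pow]; norm_num
  have hlog9 : Real.log 9 = 2 * Real.log 3 := by
    rw [show (9 : ℝ) = 3 ^ 2 by norm_num, Real.log_pow]; norm_num
  have hlog16 : Real.log 16 = 4 * Real.log 2 := by
    rw [show (16 : ℝ) = 2 ^ 4 by norm_num, Real.log_pow]; norm_num
  have hlog64 : Real.log 64 = 6 * Real.log 2 := by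
    rw [show (64 : ℝ) = 2 ^ 6 by norm_num, Real.log_pow]; norm_num
  have h3 := mul_log_two_le_log (a := 3) (k := 12) (m := 19) (by norm_num)
  have h11 := mul_log_two_le_log (a := 11) (k := 11) (m := 38) (by norm_num)
  have h37 := mul_log_two_le_log (a := 37) (k := 5) (m := 26) (by norm_num)
  have h55 : Real.log (11 / 2) = Real.log 11 - Real.log 2 :=
    Real.log_div (by norm_num) (by norm_num)
  push_cast at h3 h11 h37
  have hP10 := primeProd_10
  have hP36 := primeProd_36
  have hu11 : (2.394 : ℝ) ≤ Real.log ((10 : ℕ) + 1) := by norm_num; linarith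
  have hu37 : (3.604 : ℝ) ≤ Real.log ((36 : ℕ) + 1) := by norm_num; linarith
  rcases lt_or_ge q 55 with hlt | hge
  · have h := totient_lower_bound_of_lt_55 q hlt hq
    have ht := Nat.totient_eq_mul_prod_factors q
    have ht' : (Nat.totient q : ℝ) = q * ∏ p ∈ q.primeFactors, (1 - (p : ℝ)⁻¹) := by
      have h := congrArg (Rat.cast : ℚ → ℝ) ht
      push_cast at h
      exact h
    have h' : (q : ℝ) * 4 ≤ Nat.totient q * 15 := by exact_mod_cast h
    have hqpos : (0 : ℝ) < q := by positivity
    rw [ht', mul_assoc] at h'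
    have h'' := le_of_mul_le_mul_left h' hqpos
    have hl : 1 ≤ Real.log (Real.log q) :=
      one_le_log_log ((by norm_num : (16 : ℝ) ≤ 25).trans (by exact_mod_cast hq))
    calc 1 / (4 * Real.log (Real.log q)) ≤ 1 / (4 * 1) := by gcongr
      _ ≤ 4 / 15 := by norm_num
      _ ≤ _ := by linarith
  have hq4 : 4 ≤ Real.log q := by
    rw [Real.le_log_iff_exp_le (by positivity)]
    have h1 := Real.exp_one_lt_d9
    calc Real.exp 4 = Real.exp 1 ^ 4 := by rw [← Real.exp_nat_mul]; norm_num
      _ ≤ 2.7182818286 ^ 4 := by gcongr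
      _ ≤ 55 := by norm_num
      _ ≤ q := by exact_mod_cast hge
  rcases le_total (Real.log q) 5.5 with hb | hb
  · exact one_div_four_log_le_of_mem_interval hq0 (N := 10) (v := 1.386) (by norm_num)
      (by norm_num) hq4 hb hP10.le (by norm_num) hu11 (by norm_num)
      (by linarith) (by norm_num) (by norm_num)
  rcases le_total (Real.log q) 9 with hc | hc
  · exact one_div_four_log_le_of_mem_interval hq0 (N := 10) (v := 1.7) (by norm_num)
      (by norm_num) hb hc hP10.le (by norm_num) hu11 (by norm_num)
      (by norm_num at *; linarith) (by norm_num) (by norm_num)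
  rcases le_total (Real.log q) 16 with hd | hd
  · exact one_div_four_log_le_of_mem_interval hq0 (N := 10) (v := 2.194) (by norm_num)
      (by norm_num) hc hd hP10.le (by norm_num) hu11 (by norm_num)
      (by linarith) (by norm_num) (by norm_num)
  rcases le_total (Real.log q) 64 with he | he
  · exact one_div_four_log_le_of_mem_interval hq0 (N := 36) (v := 2.772) (by norm_num)
      (by norm_num) hd he hP36.le (by norm_num) hu37 (by norm_num)
      (by linarith) (by norm_num) (by norm_num)
  rcases le_total (Real.log q) 100 with hf | hf
  · exact one_div_four_log_le_of_mem_interval hq0 (N := 36) (v := 4.158) (by norm_num)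
      (by norm_num) he hf hP36.le (by norm_num) hu37 (by norm_num)
      (by linarith) (by norm_num) (by norm_num)
  · exact one_div_four_log_le_of_large hq0 hf

/-- The number of sequences of length `m` none of whose subsequences extends `l` to a list of
length `n` satisfying `Good`. -/
noncomputable def failCount {V : Type*} (Good : List V → Prop) (n m : ℕ) (l : List V) : ℕ :=
  Nat.card {a : Fin m → V //
    ¬ ∃ l' : List V, l'.Sublist (List.ofFn a) ∧ l'.length + l.length = n ∧ Good (l' ++ l)}

theorem failCount_eq_zero {V : Type*} {Good : List V → Prop} {n : ℕ} (m : ℕ) {l : List V}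
    (hl : Good l) (hn : l.length = n) : failCount Good n m l = 0 := by
  have : IsEmpty {a : Fin m → V //
      ¬ ∃ l' : List V, l'.Sublist (List.ofFn a) ∧ l'.length + l.length = n ∧ Good (l' ++ l)} :=
    ⟨fun a => a.2 ⟨[], by simp, by simpa using hn, by simpa using hl⟩⟩
  exact Nat.card_of_isEmpty

theorem failCount_le_pow {V : Type*} [Fintype V] (Good : List V → Prop) (n m : ℕ) (l : List V) :
    failCount Good n m l ≤ Fintype.card V ^ m := by
  calc failCount Good n m l ≤ Nat.card (Fin m → V) :=
        Nat.card_le_card_of_injective _ Subtype.val_injective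
    _ = _ := by simp

open Classical in
theorem failCount_succ_le {V : Type*} [Fintype V] (Good : List V → Prop) (n m : ℕ) (l : List V) :
    failCount Good n (m + 1) l
      ≤ ∑ x : V, if Good (x :: l) then failCount Good n m (x :: l) else failCount Good n m l := by
  let P : (Fin (m + 1) → V) → Prop := fun a =>
    ¬ ∃ l' : List V, l'.Sublist (List.ofFn a) ∧ l'.length + l.length = n ∧ Good (l' ++ l)
  have e1 : failCount Good n (m + 1) l
      = ∑ x : V, Nat.card {a : Fin m → V // P (Fin.snoc a x)} := by
    rw [← Nat.card_sigma]
    refine Nat.card_congr (Equiv.trans ?_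
      (Equiv.subtypeProdEquivSigmaSubtype fun (x : V) (a : Fin m → V) => P (Fin.snoc a x)))
    exact ((Fin.snocEquiv fun _ => V).subtypeEquiv fun _ => Iff.rfl).symm
  have hsnoc : ∀ (a : Fin m → V) (x : V),
      List.ofFn (Fin.snoc a x : Fin (m + 1) → V) = List.ofFn a ++ [x] := by
    intro a x
    rw [List.ofFn_succ']
    simp
  rw [e1]
  refine Finset.sum_le_sum fun x _ => ?_
  split_ifs with hx
  · refine Nat.card_le_card_of_injective (Subtype.map id fun a ha => ?_)
      (Subtype.map_injective _ Function.injective_id)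
    rintro ⟨l', h1, h2, h3⟩
    refine ha ⟨l' ++ [x], ?_, ?_, by simpa using h3⟩
    · rw [hsnoc]; exact h1.append_right _
    · simp at h2 ⊢; omega
  · refine Nat.card_le_card_of_injective (Subtype.map id fun a ha => ?_)
      (Subtype.map_injective _ Function.injective_id)
    rintro ⟨l', h1, h2, h3⟩
    refine ha ⟨l', ?_, h2, h3⟩
    rw [hsnoc]; exact h1.trans (List.sublist_append_left _ _)

theorem failCount_le_of_length_add_one {V : Type*} [Fintype V] {Good : List V → Prop} {n : ℕ}
    {r : ℝ} (h1 : ∀ l, Good l → l.length + 1 = n →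
      (Nat.card {x // ¬ Good (x :: l)} : ℝ) ≤ r * Fintype.card V)
    (m : ℕ) {l : List V} (hl : Good l) (hn : l.length + 1 = n) :
    (failCount Good n m l : ℝ) ≤ (r * Fintype.card V) ^ m := by
  classical
  induction m with
  | zero => simpa using failCount_le_pow Good n 0 l
  | succ m ih =>
    have h := failCount_succ_le Good n m l
    have e : ∑ x : V, (if Good (x :: l) then failCount Good n m (x :: l) else failCount Good n m l)
        = Nat.card {x // ¬ Good (x :: l)} * failCount Good n m l := by
      rw [Finset.sum_congr rfl (g := fun x => if ¬ Good (x :: l) then failCount Good n m l else 0),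
        ← Finset.sum_filter, Finset.sum_const, smul_eq_mul, Nat.card_eq_fintype_card,
        Fintype.card_subtype]
      intro x _
      by_cases hx : Good (x :: l)
      · simp [hx, failCount_eq_zero m hx (by simpa using hn)]
      · simp [hx]
    rw [e] at h
    calc (failCount Good n (m + 1) l : ℝ)
        ≤ Nat.card {x // ¬ Good (x :: l)} * failCount Good n m l := by exact_mod_cast h
      _ ≤ (r * Fintype.card V) * (r * Fintype.card V) ^ m := by
          have := h1 l hl hn
          have h0 : (0 : ℝ) ≤ r * Fintype.card V := le_trans (Nat.cast_nonneg _) this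
          gcongr
      _ = _ := by ring

theorem failCount_add_le {V : Type*} [Fintype V] {Good : List V → Prop} {n : ℕ}
    {r : ℝ} (hr0 : 0 ≤ r) (hr1 : r ≤ 1)
    (h1 : ∀ l, Good l → l.length + 1 = n →
      (Nat.card {x // ¬ Good (x :: l)} : ℝ) ≤ r * Fintype.card V)
    (h2 : ∀ l, Good l → l.length + 2 ≤ n →
      (Nat.card {x // ¬ Good (x :: l)} : ℝ) ≤ 1 / 2 * Fintype.card V)
    (M j d : ℕ) {l : List V} (hl : Good l) (hn : l.length + (d + 1) = n) :
    (failCount Good n (j + M) l : ℝ)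
      ≤ (2 ^ d / 2 * (3 / 4) ^ j + r ^ M) * (Fintype.card V : ℝ) ^ (j + M) := by
  classical
  set Q : ℝ := (Fintype.card V : ℝ) with hQ
  have hQ0 : 0 ≤ Q := Nat.cast_nonneg _
  have hlast : ∀ (j : ℕ) (l : List V), Good l → l.length + 1 = n →
      (failCount Good n (j + M) l : ℝ) ≤ (2 ^ 0 / 2 * (3 / 4) ^ j + r ^ M) * Q ^ (j + M) := by
    intro j l hl hn
    calc (failCount Good n (j + M) l : ℝ) ≤ r ^ (j + M) * Q ^ (j + M) := by
          rw [← mul_pow]; exact failCount_le_of_length_add_one h1 _ hl hn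
      _ ≤ _ := by
          gcongr
          have : r ^ (j + M) ≤ r ^ M := pow_le_pow_of_le_one hr0 hr1 (by omega)
          have : (0 : ℝ) ≤ 2 ^ 0 / 2 * (3 / 4) ^ j := by positivity
          linarith
  induction j generalizing d l with
  | zero =>
    rcases d with _ | d
    · exact hlast 0 l hl hn
    · have h : (failCount Good n (0 + M) l : ℝ) ≤ Q ^ (0 + M) := by
        rw [hQ]; exact_mod_cast failCount_le_pow Good n (0 + M) l
      refine h.trans (le_mul_of_one_le_left (by positivity) ?_)
      have : (1 : ℝ) ≤ 2 ^ d := one_le_pow₀ (by norm_num)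
      have : 0 ≤ r ^ M := by positivity
      rw [pow_succ]
      norm_num
      linarith
  | succ j ih =>
    rcases d with _ | d
    · exact hlast _ l hl hn
    · have h := failCount_succ_le Good n (j + M) l
      set b : ℝ := (Nat.card {x // ¬ Good (x :: l)} : ℝ) with hb
      have hbQ : b ≤ 1 / 2 * Q := h2 l hl (by omega)
      set G : ℝ := (2 ^ d / 2 * (3 / 4) ^ j + r ^ M) * Q ^ (j + M) with hG
      set B : ℝ := (2 ^ (d + 1) / 2 * (3 / 4) ^ j + r ^ M) * Q ^ (j + M) with hB
      have hGB : G ≤ B := by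
        rw [hG, hB]; gcongr
        · norm_num
        · omega
      have hsum : ((∑ x : V, if Good (x :: l) then failCount Good n (j + M) (x :: l)
          else failCount Good n (j + M) l : ℕ) : ℝ) ≤ (Q - b) * G + b * B := by
        push_cast
        calc (∑ x : V, if Good (x :: l) then (failCount Good n (j + M) (x :: l) : ℝ)
              else (failCount Good n (j + M) l : ℝ))
            ≤ ∑ x : V, (G + if ¬ Good (x :: l) then B - G else 0) := by
              refine Finset.sum_le_sum fun x _ => ?_
              by_cases hx : Good (x :: l)
              · simpa [hx] using ih d hx (by simp; omega)
              · simpa [hx] using ih (d + 1) hl (by omega)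
          _ = (Q - b) * G + b * B := by
              rw [Finset.sum_add_distrib, ← Finset.sum_filter, Finset.sum_const, Finset.sum_const,
                hb, Nat.card_eq_fintype_card, Fintype.card_subtype, Finset.card_univ, hQ]
              simp only [nsmul_eq_mul]
              ring
      have h' : (failCount Good n (j + M + 1) l : ℝ) ≤ (Q - b) * G + b * B :=
        le_trans (by exact_mod_cast h) hsum
      rw [show j + 1 + M = j + M + 1 by ring]
      refine h'.trans ?_
      calc (Q - b) * G + b * B = Q * G + b * (B - G) := by ring
        _ ≤ Q * G + (1 / 2 * Q) * (B - G) := by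
            have : 0 ≤ B - G := by linarith
            gcongr
        _ = _ := by rw [hG, hB]; ring

theorem AddMonoidHom.card_preimage_mul_card {G H : Type*} [AddCommGroup G] [AddCommGroup H]
    (f : G →+ H) (hf : Function.Surjective f) (S : Set H) :
    Nat.card {x // f x ∈ S} * Nat.card H = Nat.card G * Nat.card S := by
  have key : ∀ T : Set H, Nat.card {x // f x ∈ T} = Nat.card T * Nat.card f.ker := by
    intro T
    obtain ⟨g, hg⟩ := hf.hasRightInverse
    rw [← Nat.card_prod]
    exact Nat.card_congr
      { toFun := fun x => (⟨f x, x.2⟩, ⟨x - g (f x), by simp [AddMonoidHom.mem_ker, hg (f x)]⟩)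
        invFun := fun y => ⟨g y.1 + y.2, by
          have h := y.2.2
          rw [AddMonoidHom.mem_ker] at h
          simp [hg y.1.1, h]⟩
        left_inv := fun x => by simp
        right_inv := fun y => by
          have h := y.2.2
          rw [AddMonoidHom.mem_ker] at h
          ext <;> simp [hg y.1.1, h] }
  have huniv := key Set.univ
  simp only [Set.mem_univ, Nat.card_congr (Equiv.Set.univ H),
    Nat.card_congr (Equiv.subtypeUnivEquiv (p := fun _ : G => True) fun _ => trivial)] at huniv
  rw [key S, huniv]
  ring

/-- Reduction modulo `p` of a vector over `ZMod q`. -/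
def reduceVec {q n : ℕ} (p : ℕ) (v : Fin n → ZMod q) : Fin n → ZMod p := fun j => (v j).cast

/-- A list of vectors over `ZMod q` whose reduction modulo each prime factor of `q` is linearly
independent. -/
def ResidueIndependent (q n : ℕ) (l : List (Fin n → ZMod q)) : Prop :=
  ∀ p ∈ q.primeFactors, LinearIndependent (ZMod p) fun i : Fin l.length => reduceVec p (l.get i)

theorem residueIndependent_nil (q n : ℕ) : ResidueIndependent q n [] := by
  intro p _
  have : IsEmpty (Fin ([] : List (Fin n → ZMod q)).length) := Fin.isEmpty
  exact linearIndependent_empty_type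

/-- The span of the reductions modulo `p` of the vectors in a list. -/
def residueSpan {q n : ℕ} (p : ℕ) (l : List (Fin n → ZMod q)) :
    Submodule (ZMod p) (Fin n → ZMod p) :=
  Submodule.span (ZMod p) (Set.range fun i : Fin l.length => reduceVec p (l.get i))

theorem residueIndependent_cons_iff {q n : ℕ} {l : List (Fin n → ZMod q)}
    (hl : ResidueIndependent q n l) (x : Fin n → ZMod q) :
    ResidueIndependent q n (x :: l)
      ↔ ∀ p : q.primeFactors, reduceVec (p : ℕ) x ∉ residueSpan (p : ℕ) l := by
  rw [ResidueIndependent, Subtype.forall]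
  refine forall₂_congr fun p hp => ?_
  have := Fact.mk (Nat.prime_of_mem_primeFactors hp)
  have e : (fun i : Fin (x :: l).length => reduceVec p ((x :: l).get i))
      = (Fin.cons (reduceVec p x) fun i : Fin l.length => reduceVec p (l.get i)
        : Fin (l.length + 1) → Fin n → ZMod p) := by
    funext i
    refine Fin.cases ?_ (fun i => ?_) i <;> rfl
  rw [e]
  exact linearIndependent_finCons.trans (and_iff_right (hl p hp))

/-- Reduction of a vector over `ZMod q` modulo all prime factors of `q`. -/
def reducePrimeFactors (q n : ℕ) :
    (Fin n → ZMod q) →+ ∀ p : q.primeFactors, Fin n → ZMod (p : ℕ) where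
  toFun v p := reduceVec (p : ℕ) v
  map_zero' := by
    funext p j
    simp [reduceVec]
  map_add' v w := by
    funext p j
    simp [reduceVec, ZMod.cast_add (Nat.dvd_of_mem_primeFactors p.2)]

theorem reducePrimeFactors_surjective (q n : ℕ) :
    Function.Surjective (reducePrimeFactors q n) := by
  intro w
  have h : ∀ j : Fin n, ∃ c : ZMod q, ∀ p : q.primeFactors, (c.cast : ZMod (p : ℕ)) = w p j := by
    intro j
    obtain ⟨k, hk⟩ := Nat.chineseRemainderOfFinset (fun p : q.primeFactors => (w p j).val)
      (fun p => (p : ℕ)) Finset.univ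
      (fun p _ => (Nat.prime_of_mem_primeFactors p.2).ne_zero)
      (fun p _ r _ hpr => (Nat.coprime_primes (Nat.prime_of_mem_primeFactors p.2)
        (Nat.prime_of_mem_primeFactors r.2)).2 fun h => hpr (Subtype.ext h))
    refine ⟨k, fun p => ?_⟩
    have : NeZero (p : ℕ) := ⟨(Nat.prime_of_mem_primeFactors p.2).ne_zero⟩
    rw [ZMod.cast_natCast (Nat.dvd_of_mem_primeFactors p.2),
      (ZMod.natCast_eq_natCast_iff _ _ _).2 (hk p (Finset.mem_univ p)), ZMod.natCast_zmod_val]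
  choose c hc using h
  exact ⟨c, funext fun p => funext fun j => hc j p⟩

theorem card_residueIndependent_cons {q n : ℕ} [NeZero q] {l : List (Fin n → ZMod q)}
    (hl : ResidueIndependent q n l) (hn : l.length ≤ n) :
    (Nat.card {x // ResidueIndependent q n (x :: l)} : ℝ)
      = (∏ p ∈ q.primeFactors, (1 - ((p : ℝ)⁻¹) ^ (n - l.length)))
        * Fintype.card (Fin n → ZMod q) := by
  have hprime : ∀ p : q.primeFactors, Fact (p : ℕ).Prime :=
    fun p => ⟨Nat.prime_of_mem_primeFactors p.2⟩
  have hcard := AddMonoidHom.card_preimage_mul_card (reducePrimeFactors q n)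
    (reducePrimeFactors_surjective q n)
    (Set.univ.pi fun p => ((residueSpan (p : ℕ) l : Set (Fin n → ZMod (p : ℕ)))ᶜ))
  have e1 : Nat.card {x // reducePrimeFactors q n x ∈
      (Set.univ.pi fun p : q.primeFactors => ((residueSpan (p : ℕ) l : Set (Fin n → ZMod (p : ℕ)))ᶜ))}
      = Nat.card {x // ResidueIndependent q n (x :: l)} :=
    Nat.card_congr (Equiv.subtypeEquivRight fun x => by
      rw [residueIndependent_cons_iff hl]
      simp [reducePrimeFactors])
  have e2 : Nat.card (∀ p : q.primeFactors, Fin n → ZMod (p : ℕ))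
      = ∏ p : q.primeFactors, (p : ℕ) ^ n := by
    simp
  have e3 : (Nat.card (Set.univ.pi fun p : q.primeFactors =>
        ((residueSpan (p : ℕ) l : Set (Fin n → ZMod (p : ℕ)))ᶜ)) : ℝ)
      = ∏ p : q.primeFactors, (((p : ℕ) : ℝ) ^ n - ((p : ℕ) : ℝ) ^ l.length) := by
    rw [Nat.card_congr (Equiv.Set.univPi _), Nat.card_pi]
    push_cast
    refine Finset.prod_congr rfl fun p _ => ?_
    have hs : Nat.card (residueSpan (p : ℕ) l) = (p : ℕ) ^ l.length := by
      rw [Module.natCard_eq_pow_finrank (K := ZMod (p : ℕ)), residueSpan,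
        finrank_span_eq_card (hl p p.2), Nat.card_zmod, Fintype.card_fin]
    have hc := Set.ncard_add_ncard_compl (residueSpan (p : ℕ) l : Set (Fin n → ZMod (p : ℕ)))
    have hs' : (residueSpan (p : ℕ) l : Set (Fin n → ZMod (p : ℕ))).ncard
      = (p : ℕ) ^ l.length := hs
    have hu : Nat.card (Fin n → ZMod (p : ℕ)) = (p : ℕ) ^ n := by simp
    rw [hs', hu] at hc
    rw [eq_sub_iff_add_eq', Nat.card_coe_set_eq]
    exact_mod_cast hc
  rw [e1, e2] at hcard
  have hcard' := congrArg (Nat.cast : ℕ → ℝ) hcard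
  push_cast at hcard'
  rw [e3] at hcard'
  have hpos : (0 : ℝ) < ∏ p : q.primeFactors, ((p : ℕ) : ℝ) ^ n :=
    Finset.prod_pos fun p _ => pow_pos (by exact_mod_cast (hprime p).out.pos) _
  have e4 : ∏ p : q.primeFactors, (((p : ℕ) : ℝ) ^ n - ((p : ℕ) : ℝ) ^ l.length)
      = (∏ p ∈ q.primeFactors, (1 - ((p : ℝ)⁻¹) ^ (n - l.length)))
        * ∏ p : q.primeFactors, ((p : ℕ) : ℝ) ^ n := by
    rw [← Finset.prod_coe_sort q.primeFactors (fun p => 1 - ((p : ℝ)⁻¹) ^ (n - l.length)),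
      ← Finset.prod_mul_distrib]
    refine Finset.prod_congr rfl fun p _ => ?_
    have hp0 : ((p : ℕ) : ℝ) ≠ 0 := by exact_mod_cast (hprime p).out.ne_zero
    have hsplit : ((p : ℕ) : ℝ) ^ n = ((p : ℕ) : ℝ) ^ l.length * ((p : ℕ) : ℝ) ^ (n - l.length) := by
      rw [← pow_add, Nat.add_sub_cancel' hn]
    rw [hsplit, inv_pow]
    field_simp
  rw [e4, ← mul_assoc] at hcard'
  rw [mul_right_cancel₀ hpos.ne' hcard', Nat.card_eq_fintype_card, mul_comm]

theorem card_not_residueIndependent_cons {q n : ℕ} [NeZero q] {l : List (Fin n → ZMod q)}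
    (hl : ResidueIndependent q n l) (hn : l.length ≤ n) :
    (Nat.card {x // ¬ ResidueIndependent q n (x :: l)} : ℝ)
      = (1 - ∏ p ∈ q.primeFactors, (1 - ((p : ℝ)⁻¹) ^ (n - l.length)))
        * Fintype.card (Fin n → ZMod q) := by
  have h := card_residueIndependent_cons hl hn
  have hc := Set.ncard_add_ncard_compl {x | ResidueIndependent q n (x :: l)}
  have hc' : (Nat.card {x // ResidueIndependent q n (x :: l)} : ℝ)
      + Nat.card {x // ¬ ResidueIndependent q n (x :: l)} = Fintype.card (Fin n → ZMod q) := by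
    rw [← Nat.card_eq_fintype_card]
    exact_mod_cast hc
  rw [h] at hc'
  linarith

theorem prod_Icc_one_sub_inv_sq (M : ℕ) :
    1 / 2 ≤ ∏ m ∈ Finset.Icc 2 (M + 1), (1 - ((m : ℝ)⁻¹) ^ 2) := by
  have h : ∏ m ∈ Finset.Icc 2 (M + 1), (1 - ((m : ℝ)⁻¹) ^ 2) = (M + 2 : ℝ) / (2 * (M + 1)) := by
    induction M with
    | zero => simp
    | succ M ih =>
      rw [Finset.prod_Icc_succ_top (by omega), ih]
      push_cast
      field_simp
      ring
  rw [h, div_le_div_iff₀ (by norm_num) (by positivity)]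
  linarith

theorem half_le_prod_primeFactors (q : ℕ) {d : ℕ} (hd : 2 ≤ d) :
    1 / 2 ≤ ∏ p ∈ q.primeFactors, (1 - ((p : ℝ)⁻¹) ^ d) := by
  have hinv : ∀ m : ℕ, 2 ≤ m → 0 ≤ (m : ℝ)⁻¹ ∧ (m : ℝ)⁻¹ ≤ 1 := fun m hm =>
    ⟨by positivity, inv_le_one_of_one_le₀ (by exact_mod_cast (by omega : 1 ≤ m))⟩
  calc (1 : ℝ) / 2 ≤ ∏ m ∈ Finset.Icc 2 (q + 1), (1 - ((m : ℝ)⁻¹) ^ 2) := prod_Icc_one_sub_inv_sq q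
    _ ≤ ∏ p ∈ q.primeFactors, (1 - ((p : ℝ)⁻¹) ^ 2) := by
        refine Finset.prod_le_prod_of_subset_of_le_one ?_ ?_ ?_
        · intro p hp
          have := (Nat.prime_of_mem_primeFactors hp).two_le
          have := Nat.le_of_mem_primeFactors hp
          simp; omega
        · intro m hm
          obtain ⟨h0, h1⟩ := hinv m (Finset.mem_Icc.1 hm).1
          have := pow_le_one₀ (n := 2) h0 h1
          linarith
        · intro m hm _
          have : 0 ≤ ((m : ℝ)⁻¹) ^ 2 := by positivity
          linarith
    _ ≤ _ := by
        refine Finset.prod_le_prod (fun p hp => ?_) fun p hp => ?_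
        · obtain ⟨h0, h1⟩ := hinv p (Nat.prime_of_mem_primeFactors hp).two_le
          have := pow_le_one₀ (n := 2) h0 h1
          linarith
        · obtain ⟨h0, h1⟩ := hinv p (Nat.prime_of_mem_primeFactors hp).two_le
          have := pow_le_pow_of_le_one h0 h1 hd
          linarith

theorem isUnit_det_of_linearIndependent_residues {q n : ℕ} [NeZero q]
    (M : Matrix (Fin n) (Fin n) (ZMod q))
    (h : ∀ p ∈ q.primeFactors, LinearIndependent (ZMod p) fun j => reduceVec p fun i => M i j) :
    IsUnit M.det := by
  rw [← ZMod.natCast_zmod_val M.det, ZMod.isUnit_iff_coprime]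
  refine Nat.Coprime.symm ?_
  by_contra hcop
  obtain ⟨p, hp, hpq, hpd⟩ := Nat.Prime.not_coprime_iff_dvd.1 hcop
  have := Fact.mk hp
  have hli := h p (Nat.mem_primeFactors.2 ⟨hp, hpq, NeZero.ne q⟩)
  have hunit : IsUnit ((ZMod.castHom hpq (ZMod p)).mapMatrix M) :=
    Matrix.linearIndependent_cols_iff_isUnit.1 hli
  rw [Matrix.isUnit_iff_isUnit_det, ← RingHom.map_det, ← ZMod.natCast_zmod_val M.det,
    map_natCast, (ZMod.natCast_eq_zero_iff _ _).2 hpd] at hunit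
  exact not_isUnit_zero hunit

theorem exists_strictMono_isUnit_det {q n N : ℕ} [NeZero q] (a : Fin N → Fin n → ZMod q)
    {l : List (Fin n → ZMod q)} (hl : l.Sublist (List.ofFn a)) (hn : l.length = n)
    (hi : ResidueIndependent q n l) :
    ∃ g : Fin n → Fin N, StrictMono g ∧
      IsUnit (Matrix.det (fun i j => a (g j) i : Matrix (Fin n) (Fin n) (ZMod q))) := by
  obtain ⟨f, hf⟩ := List.sublist_iff_exists_fin_orderEmbedding_get_eq.1 hl
  refine ⟨fun i => Fin.cast (by simp) (f (Fin.cast hn.symm i)), ?_, ?_⟩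
  · intro i j hij
    exact f.strictMono (show Fin.cast hn.symm i < Fin.cast hn.symm j from hij)
  · refine isUnit_det_of_linearIndependent_residues _ fun p hp => ?_
    have h := (hi p hp).comp (Fin.cast hn.symm) (Fin.cast_injective _)
    convert h using 2 with j
    rw [Function.comp_apply, hf, List.get_ofFn]

theorem two_pow_mul_three_fourths_pow_le {n d : ℕ} {t : ℝ} (hd : n = d + 1) (ht : 4 ≤ t) :
    2 ^ d / 2 * (3 / 4 : ℝ) ^ ⌊t * n⌋₊ ≤ Real.exp (-(t * n) / 16) := by
  have hn : (n : ℝ) = d + 1 := by rw [hd]; push_cast; ring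
  have h2 := Real.log_two_lt_d9
  have h3 := Real.log_two_gt_d9
  have hlog : Real.log (3 / 4) ≤ -(1 / 4) := by
    have := Real.log_le_sub_one_of_pos (x := (3 / 4 : ℝ)) (by norm_num)
    linarith
  have hfl : t * n ≤ ⌊t * n⌋₊ + 1 := (Nat.lt_floor_add_one _).le
  have htn : 4 * (n : ℝ) ≤ t * n := by gcongr
  rw [← Real.log_le_iff_le_exp (by positivity), Real.log_mul (by positivity) (by positivity),
    Real.log_div (by positivity) (by norm_num), Real.log_pow, Real.log_pow]
  have hfloor := mul_le_mul_of_nonneg_left hlog (Nat.cast_nonneg (α := ℝ) ⌊t * n⌋₊)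
  have hdlog := mul_le_mul_of_nonneg_left h2.le (Nat.cast_nonneg (α := ℝ) d)
  linarith

/-- **Claim 2.13.** For any `q ≥ 25`, `n ≥ 1` and reals `t₁ ≥ 4`, `t₂ ≥ 1`: among all
sequences of `N = ⌈t₁·n + t₂·ln ln q⌉` vectors from `(ℤ/qℤ)ⁿ`, the fraction of sequences
admitting a subsequence of `n` vectors forming an invertible `n×n` matrix modulo `q` is at
least `1 − e^{−t₁n/16} − e^{−t₂/4}`.  (Stated by counting: the number of good sequences is
at least `(1 − e^{−t₁n/16} − e^{−t₂/4}) · q^{n·N}`, where `q^{n·N}` is the total number of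
sequences, so a uniformly random sequence is good with at least this probability.) -/
theorem invertible_subsequence_whp (q n : ℕ) (t₁ t₂ : ℝ)
    (hq : 25 ≤ q) (hn : 1 ≤ n) (ht₁ : 4 ≤ t₁) (ht₂ : 1 ≤ t₂) :
    (1 - Real.exp (-(t₁ * n) / 16) - Real.exp (-t₂ / 4)) *
        (q : ℝ) ^ (n * ⌈t₁ * n + t₂ * Real.log (Real.log q)⌉₊)
      ≤ (Nat.card {a : Fin ⌈t₁ * n + t₂ * Real.log (Real.log q)⌉₊ → (Fin n → ZMod q) //
          ∃ g : Fin n → Fin ⌈t₁ * n + t₂ * Real.log (Real.log q)⌉₊, StrictMono g ∧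
            IsUnit (Matrix.det (fun i j => a (g j) i))} : ℝ) := by
  have : NeZero q := ⟨by omega⟩
  obtain ⟨d, hd⟩ : ∃ d, n = d + 1 := ⟨n - 1, by omega⟩
  have hL : 1 ≤ Real.log (Real.log q) :=
    one_le_log_log ((by norm_num : (16 : ℝ) ≤ 25).trans (by exact_mod_cast hq))
  set L := Real.log (Real.log q) with hLdef
  set N := ⌈t₁ * n + t₂ * L⌉₊ with hN
  set j := ⌊t₁ * n⌋₊ with hj
  have hN' : t₁ * n + t₂ * L ≤ N := Nat.le_ceil _
  have hj' : (j : ℝ) ≤ t₁ * n := Nat.floor_le (by positivity)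
  have htL : 0 ≤ t₂ * L := by positivity
  obtain ⟨M, hM⟩ : ∃ M, N = j + M :=
    Nat.exists_eq_add_of_le (by exact_mod_cast (show (j : ℝ) ≤ N by linarith))
  have hMt : t₂ * L ≤ M := by
    rw [hM] at hN'; push_cast at hN'; linarith
  set ρ : ℝ := ∏ p ∈ q.primeFactors, (1 - (p : ℝ)⁻¹) with hρ
  have hρL : 1 / (4 * L) ≤ ρ := one_div_four_log_le q hq
  have hρ0 : 0 ≤ ρ := le_trans (by positivity) hρL
  have hρ1 : ρ ≤ 1 := Finset.prod_le_one
    (fun p hp => sub_nonneg.2 (inv_le_one_of_one_le₀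
      (by exact_mod_cast (Nat.prime_of_mem_primeFactors hp).one_le)))
    (fun p _ => sub_le_self _ (by positivity))
  have hQ : (Fintype.card (Fin n → ZMod q) : ℝ) = (q : ℝ) ^ n := by simp
  have hfail := failCount_add_le (V := Fin n → ZMod q) (Good := ResidueIndependent q n) (n := n)
    (r := 1 - ρ) (by linarith) (by linarith)
    (fun l hl hln => by
      rw [card_not_residueIndependent_cons hl (by omega), show n - l.length = 1 by omega]
      simp [hρ])
    (fun l hl hln => by
      rw [card_not_residueIndependent_cons hl (by omega)]
      have := half_le_prod_primeFactors q (d := n - l.length) (by omega)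
      gcongr
      linarith)
    M j d (l := []) (residueIndependent_nil q n) (by simp [hd])
  have hexp2 : (1 - ρ) ^ M ≤ Real.exp (-t₂ / 4) := by
    have h1 := Real.one_sub_le_exp_neg ρ
    calc (1 - ρ) ^ M ≤ Real.exp (-ρ) ^ M := by
          gcongr
      _ = Real.exp (-(M * ρ)) := by rw [← Real.exp_nat_mul]; congr 1; ring
      _ ≤ Real.exp (-t₂ / 4) := by
          refine Real.exp_le_exp.2 ?_
          have : t₂ / 4 ≤ M * ρ := by
            calc t₂ / 4 = t₂ * L * (1 / (4 * L)) := by field_simp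
              _ ≤ M * ρ := by gcongr
          linarith
  have hexp1 := two_pow_mul_three_fourths_pow_le hd ht₁
  rw [← hj] at hexp1
  have hpow : (Fintype.card (Fin n → ZMod q) : ℝ) ^ (j + M) = (q : ℝ) ^ (n * N) := by
    rw [hQ, ← pow_mul, hM]
  rw [hpow, ← hM] at hfail
  have hbound : (failCount (ResidueIndependent q n) n N [] : ℝ)
      ≤ (Real.exp (-(t₁ * n) / 16) + Real.exp (-t₂ / 4)) * (q : ℝ) ^ (n * N) :=
    hfail.trans (by gcongr)
  have hcompl := Set.ncard_add_ncard_compl {a : Fin N → Fin n → ZMod q |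
    ∃ l' : List (Fin n → ZMod q), l'.Sublist (List.ofFn a) ∧
      l'.length + ([] : List (Fin n → ZMod q)).length = n ∧ ResidueIndependent q n (l' ++ [])}
  have htotal : Nat.card (Fin N → Fin n → ZMod q) = q ^ (n * N) := by
    simp [pow_mul]
  rw [htotal] at hcompl
  have hcompl' : (Nat.card {a : Fin N → Fin n → ZMod q //
      ∃ l' : List (Fin n → ZMod q), l'.Sublist (List.ofFn a) ∧
        l'.length + ([] : List (Fin n → ZMod q)).length = n ∧ ResidueIndependent q n (l' ++ [])} : ℝ)
      + failCount (ResidueIndependent q n) n N [] = (q : ℝ) ^ (n * N) := by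
    exact_mod_cast hcompl
  refine le_trans (b := (Nat.card {a : Fin N → Fin n → ZMod q //
      ∃ l' : List (Fin n → ZMod q), l'.Sublist (List.ofFn a) ∧
        l'.length + ([] : List (Fin n → ZMod q)).length = n ∧
          ResidueIndependent q n (l' ++ [])} : ℝ)) ?_ ?_
  · linarith
  · refine Nat.cast_le.2 (Nat.card_le_card_of_injective (Subtype.map id ?_)
      (Subtype.map_injective _ Function.injective_id))
    rintro a ⟨l', h1, h2, h3⟩
    exact exists_strictMono_isUnit_det a h1 (by simpa using h2) (by simpa using h3)
end
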